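/- (Theorem 3) For every optimal conditional machine U there exists a constant c ∈ ℕ such that the following holds. For all strings a, b, let n = C(a) + C(b). Then for all nonnegative integers α, β satisfying α ≤ C(a) − c·log n, β ≤ C(b) − c·log n, and −C(a|b) + c·log n ≤ β − α ≤ C(b|a) − c·log n, there exists a string y such that |C(a|y) − α| ≤ c and |C(b|y) − β| ≤ c (differences in ℤ). -/

import Mathlib

/-- A string is a finite binary string. -/
abbrev Str : Type := List Bool

/-- A conditional machine: a partial computable function mapping a pair of
strings `(p, y)` to a string. -/
abbrev CondMachine : Type := {V : Str × Str →. Str // Partrec V}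

/-- `condC V x y` is `C_V(x|y)`: the least length of a program `p` with
`V (p, y) = x`, as an element of `ℕ∞` (it is `⊤` if no such `p` exists). -/
noncomputable def condC (V : CondMachine) (x y : Str) : ℕ∞ :=
  sInf {n : ℕ∞ | ∃ p : Str, x ∈ V.1 (p, y) ∧ (p.length : ℕ∞) = n}

/-- A conditional machine `U` is optimal if for every conditional machine `V`
there is a constant `d` with `C_U(x|y) ≤ C_V(x|y) + d` for all `x, y`. -/
def OptimalMachine (U : CondMachine) : Prop :=
  ∀ V : CondMachine, ∃ d : ℕ, ∀ x y : Str, condC U x y ≤ condC V x y + (d : ℕ∞)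

/-- For an optimal machine all complexities are finite natural numbers. -/
noncomputable def KC (U : CondMachine) (x y : Str) : ℕ := (condC U x y).toNat

/-- `log2 n = Nat.log 2 (n + 2)`, so `log2 n ≥ 1`. -/
def log2 (n : ℕ) : ℕ := Nat.log 2 (n + 2)

/-! ### Recursively enumerable predicates -/

/-- Predicates of the form `∃ s, D a s` with `D` primitive recursive. -/
def SigmaOne {α : Type*} [Primcodable α] (P : α → Prop) : Prop :=
  ∃ D : α → ℕ → Prop, PrimrecRel D ∧ ∀ a, P a ↔ ∃ s, D a s

namespace SigmaOne

variable {α β : Type*} [Primcodable α] [Primcodable β]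

theorem of_primrecPred {P : α → Prop} (h : PrimrecPred P) : SigmaOne P :=
  ⟨fun a _ => P a, h.comp Primrec.fst, fun a => by simp⟩

theorem of_iff {P Q : α → Prop} (h : SigmaOne P) (H : ∀ a, Q a ↔ P a) : SigmaOne Q := by
  obtain ⟨D, hD, hP⟩ := h
  exact ⟨D, hD, fun a => (H a).trans (hP a)⟩

theorem comp {P : β → Prop} (h : SigmaOne P) {f : α → β} (hf : Primrec f) :
    SigmaOne fun a => P (f a) := by
  obtain ⟨D, hD, hP⟩ := h
  exact ⟨fun a s => D (f a) s, hD.comp (hf.comp Primrec.fst) Primrec.snd, fun a => hP (f a)⟩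

theorem exists_bool {P : α → Prop} (h : SigmaOne P) :
    ∃ D : α × ℕ → Bool, Primrec D ∧ ∀ a, P a ↔ ∃ s, D (a, s) = true := by
  obtain ⟨D, ⟨_, hD⟩, hP⟩ := h
  exact ⟨_, hD, fun a => by simp [hP]⟩

theorem and {P Q : α → Prop} (hP : SigmaOne P) (hQ : SigmaOne Q) :
    SigmaOne fun a => P a ∧ Q a := by
  obtain ⟨D, hD, hP⟩ := hP
  obtain ⟨E, hE, hQ⟩ := hQ
  refine ⟨fun a s => D a s.unpair.1 ∧ E a s.unpair.2, ?_, fun a => ?_⟩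
  · exact (hD.comp Primrec.fst (Primrec.fst.comp (Primrec.unpair.comp Primrec.snd))).and
      (hE.comp Primrec.fst (Primrec.snd.comp (Primrec.unpair.comp Primrec.snd)))
  · change P a ∧ Q a ↔ _
    rw [hP, hQ]
    constructor
    · rintro ⟨⟨s, hs⟩, ⟨t, ht⟩⟩
      exact ⟨Nat.pair s t, by simpa using ⟨hs, ht⟩⟩
    · rintro ⟨s, hs, ht⟩
      exact ⟨⟨_, hs⟩, ⟨_, ht⟩⟩

theorem exists_snd {P : α × β → Prop} (h : SigmaOne P) : SigmaOne fun a => ∃ b, P (a, b) := by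
  obtain ⟨D, hD, hP⟩ := h.exists_bool
  let E : α → ℕ → Bool := fun a s =>
    Option.casesOn (motive := fun _ => Bool) (Encodable.decode (α := β) s.unpair.1) false
      fun b => D ((a, b), s.unpair.2)
  have hE : Primrec₂ E := by
    refine Primrec.option_casesOn
      (Primrec.decode.comp (Primrec.fst.comp (Primrec.unpair.comp Primrec.snd)))
      (Primrec.const false) (hD.comp (Primrec.pair
        (Primrec.pair (Primrec.fst.comp Primrec.fst) Primrec.snd)
        (Primrec.snd.comp (Primrec.unpair.comp (Primrec.snd.comp Primrec.fst)))))
  refine ⟨fun a s => E a s = true, Primrec.eq.comp hE (Primrec.const true), fun a => ?_⟩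
  constructor
  · rintro ⟨b, hb⟩
    obtain ⟨s, hs⟩ := (hP _).1 hb
    exact ⟨Nat.pair (Encodable.encode b) s, by simpa [E] using hs⟩
  · rintro ⟨s, hs⟩
    cases hd : Encodable.decode (α := β) s.unpair.1 with
    | none => simp [E, hd] at hs
    | some b => exact ⟨b, (hP _).2 ⟨_, by simpa [E, hd] using hs⟩⟩

theorem forall_mem {P : α × β → Prop} (h : SigmaOne P) :
    SigmaOne fun q : α × List β => ∀ b ∈ q.2, P (q.1, b) := by
  obtain ⟨D, hD, hP⟩ := h
  refine ⟨fun q s => ∀ b ∈ q.2, ∃ t < s, D (q.1, b) t, ?_, fun q => ?_⟩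
  · have h1 : PrimrecRel fun (t : ℕ) (p : β × (α × ℕ)) => D (p.2.1, p.1) t :=
      hD.comp (Primrec.pair (Primrec.fst.comp (Primrec.snd.comp Primrec.snd))
        (Primrec.fst.comp Primrec.snd)) Primrec.fst
    have h2 : PrimrecRel fun (b : β) (p : α × ℕ) => ∃ t < p.2, D (p.1, b) t :=
      PrimrecPred.of_eq (PrimrecRel.comp (f := fun q : β × (α × ℕ) => List.range q.2.2)
        (g := fun q : β × (α × ℕ) => q) h1.exists_mem_list
        (Primrec.list_range.comp (Primrec.snd.comp Primrec.snd)) Primrec.id)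
        fun q => by simp
    exact h2.forall_mem_list.comp (Primrec.snd.comp Primrec.fst)
      (Primrec.pair (Primrec.fst.comp Primrec.fst) Primrec.snd)
  · obtain ⟨a, l⟩ := q
    simp only [hP]
    constructor
    · intro h
      induction l with
      | nil => exact ⟨0, by simp⟩
      | cons b l ih =>
        obtain ⟨s, hs⟩ := ih fun b hb => h b (List.mem_cons_of_mem _ hb)
        obtain ⟨t, ht⟩ := h b List.mem_cons_self
        refine ⟨max s (t + 1), fun b' hb' => ?_⟩
        rcases List.mem_cons.1 hb' with rfl | hb'
        · exact ⟨t, by omega, ht⟩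
        · obtain ⟨t', h1, h2⟩ := hs b' hb'
          exact ⟨t', by omega, h2⟩
    · rintro ⟨s, hs⟩ b hb
      obtain ⟨t, -, ht⟩ := hs b hb
      exact ⟨t, ht⟩

theorem graph {f : α →. β} (hf : Partrec f) : SigmaOne fun q : α × β => q.2 ∈ f q.1 := by
  obtain ⟨c, hc⟩ := Nat.Partrec.Code.exists_code.1 hf
  refine ⟨fun q s => Nat.Partrec.Code.evaln s c (Encodable.encode q.1) =
    some (Encodable.encode q.2), ?_, fun q => ?_⟩
  · refine Primrec.eq.comp ?_ ?_
    · exact Nat.Partrec.Code.primrec_evaln.comp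
        (Primrec.pair (Primrec.pair Primrec.snd (Primrec.const c))
          (Primrec.encode.comp (Primrec.fst.comp Primrec.fst)))
    · exact Primrec.option_some.comp (Primrec.encode.comp (Primrec.snd.comp Primrec.fst))
  · have h := Nat.Partrec.Code.evaln_complete (c := c) (n := Encodable.encode q.1)
      (x := Encodable.encode q.2)
    simp only [Option.mem_def] at h
    rw [← h, hc]
    simp

/-- Uniformisation: a recursively enumerable relation has a partial recursive choice function. -/
theorem exists_partrec {P : α × β → Prop} (h : SigmaOne P) :
    ∃ f : α →. β, Partrec f ∧ (∀ a b, b ∈ f a → P (a, b)) ∧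
      ∀ a b, P (a, b) → ∃ b', b' ∈ f a := by
  obtain ⟨D, hD, hP⟩ := h.exists_bool
  let g : α → ℕ → Option β := fun a s =>
    (Encodable.decode (α := β) s.unpair.1).bind fun b =>
      if D ((a, b), s.unpair.2) = true then some b else none
  have hg : Primrec₂ g := by
    refine Primrec.option_bind
      (Primrec.decode.comp (Primrec.fst.comp (Primrec.unpair.comp Primrec.snd))) ?_
    refine Primrec.ite ?_ (Primrec.option_some.comp Primrec.snd) (Primrec.const none)
    exact Primrec.eq.comp (hD.comp (Primrec.pair
        (Primrec.pair (Primrec.fst.comp Primrec.fst) Primrec.snd)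
        (Primrec.snd.comp (Primrec.unpair.comp (Primrec.snd.comp Primrec.fst)))))
      (Primrec.const true)
  refine ⟨fun a => Nat.rfindOpt (g a), Partrec.rfindOpt hg.to_comp, fun a b hb => ?_,
    fun a b hb => ?_⟩
  · obtain ⟨s, hs⟩ := Nat.rfindOpt_spec hb
    simp only [g, Option.mem_def, Option.bind_eq_some_iff] at hs
    obtain ⟨b', -, hb'⟩ := hs
    split_ifs at hb' with hD'
    cases hb'
    exact (hP _).2 ⟨_, hD'⟩
  · obtain ⟨s, hs⟩ := (hP _).1 hb
    have : (Nat.rfindOpt (g a)).Dom :=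
      Nat.rfindOpt_dom.2 ⟨Nat.pair (Encodable.encode b) s, b, by simp [g, hs]⟩
    exact ⟨_, Part.get_mem this⟩

end SigmaOne

/-! ### Binary values and self-delimiting parameters -/

/-- The number with binary expansion `r`, most significant digit first. -/
def binVal (r : Str) : ℕ := r.foldl (fun n b => 2 * n + b.toNat) 0

theorem binVal_concat (r : Str) (b : Bool) : binVal (r ++ [b]) = 2 * binVal r + b.toNat := by
  simp [binVal]

theorem binVal_lt (r : Str) : binVal r < 2 ^ r.length := by
  induction r using List.reverseRecOn with
  | nil => simp [binVal]
  | append_singleton r b ih =>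
    rw [binVal_concat, List.length_append, List.length_singleton, pow_succ]
    cases b <;> simp <;> omega

theorem exists_binVal_eq (k : ℕ) : ∀ i < 2 ^ k, ∃ r : Str, r.length = k ∧ binVal r = i := by
  induction k with
  | zero => intro i hi; exact ⟨[], rfl, by simp at hi; simp [binVal, hi]⟩
  | succ k ih =>
    intro i hi
    obtain ⟨r, hr, hv⟩ := ih (i / 2) (by rw [pow_succ] at hi; omega)
    refine ⟨r ++ [decide (i % 2 = 1)], by simp [hr], ?_⟩
    rw [binVal_concat, hv]
    rcases Nat.mod_two_eq_zero_or_one i with h | h <;> simp [h] <;> omega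

theorem binVal_injective_of_length {r s : Str} (hl : r.length = s.length)
    (h : binVal r = binVal s) : r = s := by
  induction r using List.reverseRecOn generalizing s with
  | nil => exact (List.eq_nil_of_length_eq_zero hl.symm).symm
  | append_singleton r b ih =>
    rcases List.eq_nil_or_concat s with rfl | ⟨s, c, rfl⟩
    · simp at hl
    · rw [List.concat_eq_append] at *
      rw [binVal_concat, binVal_concat] at h
      have hbc : b = c ∧ binVal r = binVal s := by
        cases b <;> cases c <;> simp at h ⊢ <;> omega
      rw [ih (by simpa using hl) hbc.2, hbc.1]

theorem primrec_binVal : Primrec binVal := by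
  have hb : Primrec Bool.toNat := Primrec.dom_finite _
  have h : Primrec₂ fun (_ : Str) (q : ℕ × Bool) => 2 * q.1 + q.2.toNat :=
    Primrec.nat_add.comp
      (Primrec.nat_mul.comp (Primrec.const 2) (Primrec.fst.comp Primrec.snd))
      (hb.comp (Primrec.snd.comp Primrec.snd))
  exact Primrec.list_foldl Primrec.id (Primrec.const 0) h

/-- Splits a program `1^j 0 w r` with `|w| = j` into the number coded by `w` and the rest `r`. -/
def splitParam (p : Str) : ℕ × Str :=
  (binVal ((p.drop ((p.takeWhile id).length + 1)).take (p.takeWhile id).length),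
    (p.drop ((p.takeWhile id).length + 1)).drop (p.takeWhile id).length)

theorem primrec_splitParam : Primrec splitParam := by
  have h1 : Primrec fun p : Str => (p.takeWhile id).length :=
    Primrec.list_length.comp (Primrec.list_takeWhile Primrec.id)
  have h2 : Primrec fun p : Str => p.drop ((p.takeWhile id).length + 1) :=
    Primrec.list_drop.comp (Primrec.succ.comp h1) Primrec.id
  exact Primrec.pair (primrec_binVal.comp (Primrec.list_take.comp h1 h2))
    (Primrec.list_drop.comp h1 h2)

theorem exists_splitParam_eq {t j : ℕ} (h : t < 2 ^ j) (r : Str) :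
    ∃ p : Str, splitParam p = (t, r) ∧ p.length = r.length + 2 * j + 1 := by
  obtain ⟨w, hw, rfl⟩ := exists_binVal_eq j t h
  refine ⟨List.replicate j true ++ false :: (w ++ r), ?_, by simp; omega⟩
  have h1 : ((List.replicate j true ++ false :: (w ++ r)).takeWhile id).length = j := by
    simp
  have h2 : (List.replicate j true ++ false :: (w ++ r)).drop (j + 1) = w ++ r := by
    simp [List.drop_append]
  rw [splitParam, h1, h2, ← hw]
  simp

/-! ### Complexity of an optimal machine -/

theorem condC_le (U : CondMachine) {x y p : Str} (h : x ∈ U.1 (p, y)) :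
    condC U x y ≤ p.length :=
  sInf_le ⟨p, h, rfl⟩

theorem exists_program {U : CondMachine} (hU : OptimalMachine U) (x y : Str) :
    ∃ p : Str, p.length = KC U x y ∧ x ∈ U.1 (p, y) := by
  have hne : {n : ℕ∞ | ∃ p : Str, x ∈ U.1 (p, y) ∧ (p.length : ℕ∞) = n}.Nonempty := by
    by_contra hne
    rw [Set.not_nonempty_iff_eq_empty] at hne
    obtain ⟨d, hd⟩ := hU ⟨fun q => Part.some q.1, Computable.fst.partrec⟩
    have h1 := hd x y
    have h2 : condC ⟨fun q => Part.some q.1, Computable.fst.partrec⟩ x y ≤ x.length :=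
      condC_le _ (by simp)
    have h3 : condC U x y = ⊤ := by rw [condC, hne, sInf_empty]
    rw [h3, top_le_iff] at h1
    exact absurd (h1 ▸ add_le_add_left h2 _) (by
      rw [not_le, ← Nat.cast_add]; exact ENat.natCast_lt_top _)
  obtain ⟨p, hp, hl⟩ := csInf_mem hne
  refine ⟨p, ?_, hp⟩
  rw [KC, condC, ← hl, ENat.toNat_natCast]

theorem KC_le {U : CondMachine} {x y p : Str} (h : x ∈ U.1 (p, y)) :
    KC U x y ≤ p.length :=
  ENat.toNat_le_of_le_natCast (condC_le U h)

theorem KC_lt_iff {U : CondMachine} (hU : OptimalMachine U) {x y : Str} {k : ℕ} :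
    KC U x y < k ↔ ∃ p : Str, p.length < k ∧ x ∈ U.1 (p, y) := by
  constructor
  · intro h
    obtain ⟨p, hp, hx⟩ := exists_program hU x y
    exact ⟨p, hp ▸ h, hx⟩
  · rintro ⟨p, hp, hx⟩
    exact (KC_le hx).trans_lt hp

/-- Optimality for machines that receive, besides the program, a numerical parameter. -/
theorem KC_le_of_partrec {U : CondMachine} (hU : OptimalMachine U)
    {V : (Str × ℕ) × Str →. Str} (hV : Partrec V) :
    ∃ d : ℕ, ∀ (r : Str) (t : ℕ) (y x : Str) (j : ℕ), t < 2 ^ j → x ∈ V ((r, t), y) →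
      KC U x y ≤ r.length + 2 * j + d := by
  let V' : Str × Str →. Str := fun q => V (((splitParam q.1).2, (splitParam q.1).1), q.2)
  have hV' : Partrec V' := by
    refine hV.comp (Primrec.to_comp ?_)
    have h := primrec_splitParam.comp (Primrec.fst (α := Str) (β := Str))
    exact Primrec.pair (Primrec.pair (Primrec.snd.comp h) (Primrec.fst.comp h)) Primrec.snd
  obtain ⟨d, hd⟩ := hU ⟨V', hV'⟩
  refine ⟨d + 1, fun r t y x j ht hx => ?_⟩
  obtain ⟨p, hp, hl⟩ := exists_splitParam_eq ht r
  have h1 : condC ⟨V', hV'⟩ x y ≤ p.length := condC_le _ (by simpa [V', hp] using hx)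
  have h2 : condC U x y ≤ ((p.length + d : ℕ) : ℕ∞) := by
    push_cast
    exact (hd x y).trans (by gcongr)
  have h3 := ENat.toNat_le_of_le_natCast h2
  rw [← KC] at h3
  omega

/-- Transforming the condition by `F` (with a parameter `t`) and the output by `G`. -/
theorem KC_transform {U : CondMachine} (hU : OptimalMachine U)
    {F : Str × ℕ →. Str} (hF : Partrec F) {G : Str →. Str} (hG : Partrec G) :
    ∃ d : ℕ, ∀ (y y' x w : Str) (t j : ℕ), t < 2 ^ j → y' ∈ F (y, t) → w ∈ G x →
      KC U w y ≤ KC U x y' + 2 * j + d := by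
  have hV : Partrec fun q : (Str × ℕ) × Str =>
      (F (q.2, q.1.2)).bind fun y' => (U.1 (q.1.1, y')).bind G := by
    refine Partrec.bind (hF.comp ?_) ?_
    · exact (Primrec.pair Primrec.snd (Primrec.snd.comp Primrec.fst)).to_comp
    · refine Partrec.bind (U.2.comp ?_) (hG.comp Computable.snd)
      exact (Primrec.pair (Primrec.fst.comp (Primrec.fst.comp Primrec.fst)) Primrec.snd).to_comp
  obtain ⟨d, hd⟩ := KC_le_of_partrec hU hV
  refine ⟨d, fun y y' x w t j ht hy hw => ?_⟩
  obtain ⟨p, hp, hx⟩ := exists_program hU x y'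
  rw [← hp]
  refine hd p t y w j ht ?_
  exact Part.mem_bind hy (Part.mem_bind hx hw)

/-! ### The enumeration lemma -/

/-- Enumeration without repetition of the strings `x` with `D x s` for some `s`. -/
def enumList (D : Str → ℕ → Bool) : ℕ → List Str
  | 0 => []
  | n + 1 =>
    match Encodable.decode (α := Str) n.unpair.1 with
    | none => enumList D n
    | some x => if D x n.unpair.2 = true ∧ x ∉ enumList D n then enumList D n ++ [x]
        else enumList D n

theorem enumList_isPrefix (D : Str → ℕ → Bool) {m n : ℕ} (h : m ≤ n) :
    enumList D m <+: enumList D n := by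
  induction n, h using Nat.le_induction with
  | base => exact List.prefix_rfl
  | succ n _ ih =>
    refine ih.trans ?_
    rw [enumList]
    split
    · exact List.prefix_rfl
    · split_ifs
      · exact List.prefix_append _ _
      · exact List.prefix_rfl

theorem enumList_nodup (D : Str → ℕ → Bool) (n : ℕ) :
    (enumList D n).Nodup ∧ ∀ x ∈ enumList D n, ∃ s, D x s = true := by
  induction n with
  | zero => simp [enumList]
  | succ n ih =>
    rw [enumList]
    split
    · exact ih
    · rename_i x _
      split_ifs with h
      · refine ⟨List.nodup_append.2 ⟨ih.1, by simp, ?_⟩, fun z hz => ?_⟩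
        · intro z hz w hw
          rintro rfl
          exact h.2 (by simpa [List.mem_singleton.1 hw] using hz)
        · rcases List.mem_append.1 hz with hz | hz
          · exact ih.2 z hz
          · rw [List.mem_singleton.1 hz]
            exact ⟨_, h.1⟩
      · exact ih

theorem mem_enumList (D : Str → ℕ → Bool) {x : Str} {s : ℕ} (h : D x s = true) :
    x ∈ enumList D (Nat.pair (Encodable.encode x) s + 1) := by
  simp only [enumList, Nat.unpair_pair, Encodable.encodek, h, true_and]
  split_ifs with hx
  · exact hx
  · simp

theorem primrec_enumList {α : Type*} [Primcodable α] {D : α → Str → ℕ → Bool}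
    (hD : Primrec fun q : α × Str × ℕ => D q.1 q.2.1 q.2.2) :
    Primrec₂ fun (a : α) (n : ℕ) => enumList (D a) n := by
  let step : α → ℕ × List Str → List Str := fun a q =>
    Option.casesOn (motive := fun _ => List Str) (Encodable.decode (α := Str) q.1.unpair.1) q.2
      fun x => if D a x q.1.unpair.2 = true ∧ x ∉ q.2 then q.2 ++ [x] else q.2
  have hstep : Primrec₂ step := by
    have hn : Primrec fun q : α × ℕ × List Str => q.2.1.unpair :=
      Primrec.unpair.comp (Primrec.fst.comp Primrec.snd)
    refine Primrec.option_casesOn (Primrec.decode.comp (Primrec.fst.comp hn))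
      (Primrec.snd.comp Primrec.snd) ?_
    have hl : Primrec fun q : (α × ℕ × List Str) × Str => q.1.2.2 :=
      Primrec.snd.comp (Primrec.snd.comp Primrec.fst)
    have hD' : Primrec fun q : (α × ℕ × List Str) × Str => D q.1.1 q.2 q.1.2.1.unpair.2 :=
      hD.comp (Primrec.pair (Primrec.fst.comp Primrec.fst)
        (Primrec.pair Primrec.snd (Primrec.snd.comp (hn.comp Primrec.fst))))
    refine Primrec.ite ((Primrec.eq.comp hD' (Primrec.const true)).and ?_)
      (Primrec.list_concat.comp hl Primrec.snd) hl
    have h1 : PrimrecRel fun (l : List Str) (x : Str) => ∃ z ∈ l, z = x :=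
      PrimrecRel.exists_mem_list Primrec.eq
    exact ((h1.comp hl Primrec.snd).of_eq fun q => by simp).not
  have h := Primrec.nat_rec (Primrec.const ([] : List Str)) hstep
  refine h.of_eq fun a n => ?_
  induction n with
  | zero => rfl
  | succ n ih =>
    simp only [enumList, ← ih, step]
    split <;> rename_i heq <;> simp only [heq]

/-- If the section of a recursively enumerable relation has at most `2 ^ k` elements, all of them
have complexity at most `k`, up to the length of the parameter and a constant. -/
theorem KC_le_of_card {U : CondMachine} (hU : OptimalMachine U)
    {W : Str × Str × ℕ × ℕ → Prop} (hW : SigmaOne W) :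
    ∃ d : ℕ, ∀ (y : Str) (t k j : ℕ), t < 2 ^ j →
      (∀ S : Finset Str, (∀ x ∈ S, W (x, y, t, k)) → S.card ≤ 2 ^ k) →
      ∀ x, W (x, y, t, k) → KC U x y ≤ k + 2 * j + d := by
  obtain ⟨D, hD, hWD⟩ := hW.exists_bool
  let E : Str × ℕ × ℕ → Str → ℕ → Bool := fun q x s => D ((x, q), s)
  have hE : Primrec₂ fun (q : Str × ℕ × ℕ) (n : ℕ) => enumList (E q) n :=
    primrec_enumList (hD.comp (Primrec.pair
      (Primrec.pair (Primrec.fst.comp Primrec.snd) Primrec.fst)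
      (Primrec.snd.comp Primrec.snd)))
  let g : (Str × ℕ) × Str → ℕ → Option Str := fun q n =>
    (enumList (E (q.2, q.1.2, q.1.1.length)) n)[binVal q.1.1]?
  have hg : Primrec₂ g := by
    refine Primrec.list_getElem?.comp (hE.comp ?_ Primrec.snd)
      (primrec_binVal.comp (Primrec.fst.comp (Primrec.fst.comp Primrec.fst)))
    exact Primrec.pair (Primrec.snd.comp Primrec.fst) (Primrec.pair
      (Primrec.snd.comp (Primrec.fst.comp Primrec.fst))
      (Primrec.list_length.comp (Primrec.fst.comp (Primrec.fst.comp Primrec.fst))))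
  obtain ⟨d, hd⟩ := KC_le_of_partrec hU (Partrec.rfindOpt hg.to_comp)
  refine ⟨d, fun y t k j ht hcard x hx => ?_⟩
  obtain ⟨s, hs⟩ := (hWD _).1 hx
  have hmem := mem_enumList (E (y, t, k)) (x := x) (s := s) (by simpa [E] using hs)
  set n := Nat.pair (Encodable.encode x) s + 1
  obtain ⟨i, hi, hix⟩ := List.getElem_of_mem hmem
  have hnd := enumList_nodup (E (y, t, k)) n
  have hlen : (enumList (E (y, t, k)) n).length ≤ 2 ^ k := by
    rw [← List.toFinset_card_of_nodup hnd.1]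
    refine hcard _ fun z hz => ?_
    obtain ⟨s', hs'⟩ := hnd.2 z (List.mem_toFinset.1 hz)
    exact (hWD _).2 ⟨s', by simpa [E] using hs'⟩
  obtain ⟨r, hr, hv⟩ := exists_binVal_eq k i (hi.trans_le hlen)
  rw [← hr]
  refine hd r t y x j ht ?_
  rw [Nat.rfindOpt_mono]
  · refine ⟨n, ?_⟩
    simp only [g, hr, hv, Option.mem_def]
    rw [List.getElem?_eq_getElem hi, hix]
  · intro z m m' hm hz
    simp only [g, Option.mem_def] at hz ⊢
    obtain ⟨h1, h2⟩ := List.getElem?_eq_some_iff.1 hz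
    obtain ⟨l, hl⟩ := enumList_isPrefix (E (y, t, r.length)) hm
    simp only [← hl]
    rw [List.getElem?_append_left h1, hz]

/-! ### Logarithmic parameters -/

theorem log2_pos (n : ℕ) : 1 ≤ log2 n :=
  Nat.log_pos (by norm_num) (by omega)

theorem lt_two_pow_log2 (n : ℕ) : n + 2 < 2 ^ (log2 n + 1) :=
  Nat.lt_pow_succ_log_self (by norm_num) _

theorem log2_add_le_add (n d : ℕ) : log2 (n + d) ≤ log2 n + d := by
  refine Nat.lt_succ_iff.1 (Nat.log_lt_of_lt_pow (by omega) ?_)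
  calc n + d + 2 ≤ (n + 2) * (d + 1) := by nlinarith
    _ ≤ (n + 2) * 2 ^ d := Nat.mul_le_mul_left _ Nat.lt_two_pow_self
    _ < 2 ^ (log2 n + 1) * 2 ^ d := Nat.mul_lt_mul_of_pos_right (lt_two_pow_log2 n) (by positivity)
    _ = 2 ^ (log2 n + d).succ := by rw [← pow_add]; congr 1; omega

theorem log2_add_le (n d : ℕ) : log2 (n + d) ≤ (d + 1) * log2 n := by
  nlinarith [log2_pos n, log2_add_le_add n d]

theorem log2_two_mul_add_le (n d : ℕ) : log2 (2 * n + d) ≤ (d + 2) * log2 n := by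
  have h : log2 (2 * n) ≤ log2 n + 1 := by
    refine Nat.lt_succ_iff.1 (Nat.log_lt_of_lt_pow (by omega) ?_)
    have := lt_two_pow_log2 n
    rw [Nat.succ_eq_add_one, pow_succ]
    omega
  nlinarith [log2_pos n, log2_add_le_add (2 * n) d]

theorem pair_lt_two_pow {N t₁ t₂ t₃ : ℕ} (h₁ : t₁ ≤ N) (h₂ : t₂ ≤ N) (h₃ : t₃ ≤ N) :
    Nat.pair t₁ (Nat.pair t₂ t₃) < 2 ^ (8 * log2 N) := by
  have hN : N + 2 < 2 ^ (2 * log2 N) :=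
    (lt_two_pow_log2 N).trans_le (Nat.pow_le_pow_right (by norm_num) (by have := log2_pos N; omega))
  have h23 : Nat.pair t₂ t₃ < (N + 1) ^ 2 :=
    (Nat.pair_lt_max_add_one_sq _ _).trans_le
      (Nat.pow_le_pow_left (by simp only [add_le_add_iff_right]; exact max_le h₂ h₃) 2)
  have h123 : Nat.pair t₁ (Nat.pair t₂ t₃) < ((N + 1) ^ 2) ^ 2 :=
    (Nat.pair_lt_max_add_one_sq _ _).trans_le
      (Nat.pow_le_pow_left (by
        rcases max_cases t₁ (Nat.pair t₂ t₃) with h | h <;> nlinarith) 2)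
  calc Nat.pair t₁ (Nat.pair t₂ t₃) < ((N + 1) ^ 2) ^ 2 := h123
    _ = (N + 1) ^ 4 := by ring
    _ ≤ (2 ^ (2 * log2 N)) ^ 4 := Nat.pow_le_pow_left (by omega) 4
    _ = 2 ^ (8 * log2 N) := by rw [← pow_mul]; congr 1; omega

theorem KC_le_of_card_log {U : CondMachine} (hU : OptimalMachine U)
    {W : Str × Str × (ℕ × ℕ × ℕ) → Prop} (hW : SigmaOne W) :
    ∃ d : ℕ, ∀ (N : ℕ) (y : Str) (t₁ t₂ t₃ k : ℕ), t₁ ≤ N → t₂ ≤ N → t₃ ≤ N →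
      (∀ S : Finset Str, (∀ x ∈ S, W (x, y, t₁, t₂, t₃)) → S.card ≤ 2 ^ k) →
      ∀ x, W (x, y, t₁, t₂, t₃) → KC U x y ≤ k + d * log2 N := by
  have hf : Primrec fun q : Str × Str × ℕ × ℕ => (q.1, q.2.1,
      (q.2.2.1.unpair.1, q.2.2.1.unpair.2.unpair.1, q.2.2.1.unpair.2.unpair.2)) := by
    have h1 : Primrec fun q : Str × Str × ℕ × ℕ => q.2.2.1.unpair :=
      Primrec.unpair.comp (Primrec.fst.comp (Primrec.snd.comp Primrec.snd))
    have h2 : Primrec fun q : Str × Str × ℕ × ℕ => q.2.2.1.unpair.2.unpair :=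
      Primrec.unpair.comp (Primrec.snd.comp h1)
    exact Primrec.pair Primrec.fst (Primrec.pair (Primrec.fst.comp Primrec.snd)
      (Primrec.pair (Primrec.fst.comp h1)
        (Primrec.pair (Primrec.fst.comp h2) (Primrec.snd.comp h2))))
  obtain ⟨d, hd⟩ := KC_le_of_card hU (hW.comp hf)
  refine ⟨16 + d, fun N y t₁ t₂ t₃ k h₁ h₂ h₃ hS x hx => ?_⟩
  have h := hd y (Nat.pair t₁ (Nat.pair t₂ t₃)) k _ (pair_lt_two_pow h₁ h₂ h₃)
    (by simpa using hS) x (by simpa using hx)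
  nlinarith [log2_pos N]

theorem KC_transform_log {U : CondMachine} (hU : OptimalMachine U)
    {F : Str × ℕ →. Str} (hF : Partrec F) :
    ∃ d : ℕ, ∀ (N : ℕ) (y y' x : Str) (t : ℕ), t ≤ N → y' ∈ F (y, t) →
      KC U x y ≤ KC U x y' + d * log2 N := by
  obtain ⟨d, hd⟩ := KC_transform hU hF Partrec.some
  refine ⟨2 * 2 + d, fun N y y' x t ht hy => ?_⟩
  have h1 : t < 2 ^ (2 * log2 N) :=
    (show t < N + 2 by omega).trans ((lt_two_pow_log2 N).trans_le
      (Nat.pow_le_pow_right (by norm_num) (by have := log2_pos N; omega)))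
  have h := hd y y' x x t _ h1 hy (by simp)
  nlinarith [log2_pos N]

/-! ### Counting strings of bounded complexity -/

/-- An injective numbering of strings. -/
def strIdx (s : Str) : ℕ := binVal (true :: s)

theorem strIdx_eq (s : Str) : strIdx s = 2 ^ s.length + binVal s := by
  induction s using List.reverseRecOn with
  | nil => simp [strIdx, binVal]
  | append_singleton s b ih =>
    rw [strIdx, ← List.cons_append, binVal_concat, binVal_concat, ← strIdx, ih]
    simp [pow_succ]
    ring

theorem strIdx_lt {s : Str} {k : ℕ} (h : s.length < k) : strIdx s < 2 ^ k := by
  have h1 := binVal_lt s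
  have h2 : 2 ^ (s.length + 1) ≤ 2 ^ k := Nat.pow_le_pow_right (by norm_num) h
  rw [strIdx_eq]
  rw [pow_succ] at h2
  omega

theorem strIdx_injective : Function.Injective strIdx := by
  intro s t h
  have hlen : ∀ {s t : Str}, strIdx s = strIdx t → s.length ≤ t.length := by
    intro s t h
    by_contra! hlt
    have := strIdx_lt hlt
    rw [← h, strIdx_eq] at this
    omega
  have hl := le_antisymm (hlen h) (hlen h.symm)
  rw [strIdx_eq, strIdx_eq, hl] at h
  exact binVal_injective_of_length hl (by omega)

/-- A finite set is counted by an injective assignment of pairs of short strings. -/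
theorem card_le_of_programs {ι : Type*} (S : Finset ι) (k l : ℕ) (P : ι → Str → Str → Prop)
    (hex : ∀ i ∈ S, ∃ p q : Str, p.length < k ∧ q.length < l ∧ P i p q)
    (hinj : ∀ i ∈ S, ∀ j ∈ S, ∀ p q, P i p q → P j p q → i = j) :
    S.card ≤ 2 ^ (k + l) := by
  classical
  choose! f g hf hg hP using hex
  have h : S.card ≤ (Finset.range (2 ^ k) ×ˢ Finset.range (2 ^ l)).card := by
    refine Finset.card_le_card_of_injOn (fun i => (strIdx (f i), strIdx (g i))) ?_ ?_
    · intro i hi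
      simpa using ⟨strIdx_lt (hf i hi), strIdx_lt (hg i hi)⟩
    · intro i hi j hj hij
      simp only [Prod.mk.injEq] at hij
      have h1 := strIdx_injective hij.1
      have h2 := strIdx_injective hij.2
      exact hinj i hi j hj _ _ (hP i hi) (h1 ▸ h2 ▸ hP j hj)
  simpa [pow_add] using h

theorem card_le_of_KC_lt {U : CondMachine} (hU : OptimalMachine U) (S : Finset Str) (y : Str)
    (k : ℕ) (h : ∀ x ∈ S, KC U x y < k) : S.card ≤ 2 ^ k := by
  choose! p hp hx using fun x (hx : x ∈ S) => (KC_lt_iff hU).1 (h x hx)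
  have h1 : S.card ≤ (Finset.range (2 ^ k)).card := by
    refine Finset.card_le_card_of_injOn (fun x => strIdx (p x)) ?_ ?_
    · intro x hxS
      simpa using strIdx_lt (hp x hxS)
    · intro x hxS x' hxS' he
      have he : p x = p x' := strIdx_injective he
      exact Part.mem_unique (hx x hxS) (he ▸ hx x' hxS')
  simpa using h1

theorem primrec_pow : Primrec₂ fun m n : ℕ => m ^ n := by
  have h : Primrec₂ fun (m n : ℕ) => Nat.rec (motive := fun _ => ℕ) 1 (fun _ ih => ih * m) n :=
    Primrec.nat_rec (Primrec.const 1) (Primrec.nat_mul.comp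
      (Primrec.snd.comp Primrec.snd) Primrec.fst).to₂
  refine h.of_eq fun m n => ?_
  induction n with
  | zero => rfl
  | succ n ih => rw [pow_succ, ← ih]

/-! ### Structured conditions -/

/-- Conditions: a string, a table of strings, and two further strings. -/
abbrev Cnd : Type := Str × List Str × Str × Str

/-- The string coding a condition. -/
def cnd (q : Cnd) : Str := List.replicate (Encodable.encode q) true

/-- The inverse of `cnd`. -/
def uncnd (y : Str) : Cnd := (Encodable.decode (α := Cnd) y.length).getD default

@[simp] theorem uncnd_cnd (q : Cnd) : uncnd (cnd q) = q := by simp [uncnd, cnd]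

theorem primrec_cnd : Primrec cnd := by
  have h : Primrec fun q : Cnd => (List.range (Encodable.encode q)).map fun _ => true :=
    Primrec.list_map (Primrec.list_range.comp Primrec.encode) (Primrec.const true).to₂
  exact h.of_eq fun q => by simp [cnd]

theorem primrec_uncnd : Primrec uncnd :=
  Primrec.option_getD.comp (Primrec.decode.comp Primrec.list_length) (Primrec.const default)

namespace SigmaOne

variable {α β : Type*} [Primcodable α] [Primcodable β]

theorem KC_lt {U : CondMachine} (hU : OptimalMachine U) {f g : α → Str} {h : α → ℕ}
    (hf : Primrec f) (hg : Primrec g) (hh : Primrec h) :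
    SigmaOne fun a => KC U (f a) (g a) < h a := by
  have h1 : SigmaOne fun q : α × Str => q.2.length < h q.1 :=
    of_primrecPred (Primrec.nat_lt.comp (Primrec.list_length.comp Primrec.snd)
      (hh.comp Primrec.fst))
  have h2 : SigmaOne fun q : α × Str => f q.1 ∈ U.1 (q.2, g q.1) :=
    (graph U.2).comp (f := fun q : α × Str => ((q.2, g q.1), f q.1))
      (Primrec.pair (Primrec.pair Primrec.snd (hg.comp Primrec.fst)) (hf.comp Primrec.fst))
  exact (h1.and h2).exists_snd.of_iff fun a => KC_lt_iff hU

theorem exists_finset [DecidableEq β] {P : α × β → Prop} (h : SigmaOne P) {K : α → ℕ}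
    (hK : Primrec K) (e : ℕ) :
    SigmaOne fun a => ∃ S : Finset β, K a ≤ e * S.card ∧ ∀ b ∈ S, P (a, b) := by
  have hnd : PrimrecPred fun l : List β => l.Nodup := by
    have h1 : PrimrecRel fun (b : β) (l : List β) => (l.filter (· = b)).length ≤ 1 :=
      Primrec.nat_le.comp (Primrec.list_length.comp
        ((PrimrecRel.listFilter Primrec.eq).comp Primrec.snd Primrec.fst)) (Primrec.const 1)
    refine (h1.forall_mem_list.comp Primrec.id Primrec.id).of_eq fun l => ?_
    rw [List.nodup_iff_count_le_one]
    constructor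
    · intro h b
      by_cases hb : b ∈ l
      · have := h b hb
        simp only [id, List.count_eq_length_filter] at this ⊢
        convert this using 3
        exact funext fun z => beq_eq_decide z b
      · rw [List.count_eq_zero_of_not_mem hb]; omega
    · intro h b _
      have := h b
      simp only [id, List.count_eq_length_filter] at this ⊢
      convert this using 3
      exact funext fun z => (beq_eq_decide z b).symm
  have hlen : SigmaOne fun q : α × List β => q.2.Nodup ∧ K q.1 ≤ e * q.2.length :=
    of_primrecPred ((hnd.comp Primrec.snd).and (Primrec.nat_le.comp (hK.comp Primrec.fst)
      (Primrec.nat_mul.comp (Primrec.const e) (Primrec.list_length.comp Primrec.snd))))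
  refine (hlen.and h.forall_mem).exists_snd.of_iff fun a => ?_
  constructor
  · rintro ⟨S, hS, hP⟩
    exact ⟨S.toList, ⟨S.nodup_toList, by simpa using hS⟩, by simpa using hP⟩
  · rintro ⟨l, ⟨hl, hc⟩, hP⟩
    exact ⟨l.toFinset, by simpa [List.toFinset_card_of_nodup hl] using hc, by simpa using hP⟩

end SigmaOne

/-! ### Symmetry of information -/

theorem symmetry_of_information {U : CondMachine} (hU : OptimalMachine U) :
    ∃ d : ℕ, ∀ (N : ℕ) (x b : Str) (q : List Str × Str × Str),
      KC U b (cnd ([], q)) ≤ N → KC U x (cnd (b, q)) ≤ N →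
      KC U x (cnd ([], q)) + KC U b (cnd (x, q)) ≤
        KC U b (cnd ([], q)) + KC U x (cnd (b, q)) + d * log2 N := by
  classical
  -- `pairs` lists the pairs of bounded complexity of which `(x, b)` is one
  let pairs : Str → Str → List Str × Str × Str → ℕ → ℕ → Prop := fun x b q m l =>
    KC U b (cnd ([], q)) < m ∧ KC U x (cnd (b, q)) < l
  have hpairs {α : Type} [Primcodable α] {x b : α → Str} {q : α → List Str × Str × Str}
      {m l : α → ℕ} (hx : Primrec x) (hb : Primrec b) (hq : Primrec q) (hm : Primrec m)
      (hl : Primrec l) : SigmaOne fun a => pairs (x a) (b a) (q a) (m a) (l a) :=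
    (SigmaOne.KC_lt hU hb (primrec_cnd.comp (Primrec.pair (Primrec.const []) hq)) hm).and
      (SigmaOne.KC_lt hU hx (primrec_cnd.comp (Primrec.pair hb hq)) hl)
  have hq : Primrec fun p : Str × Str × (ℕ × ℕ × ℕ) => uncnd p.2.1 :=
    primrec_uncnd.comp (Primrec.fst.comp Primrec.snd)
  have ht : Primrec fun p : Str × Str × (ℕ × ℕ × ℕ) => p.2.2 := Primrec.snd.comp Primrec.snd
  have ht1 := Primrec.fst.comp ht
  have ht2 := Primrec.fst.comp (Primrec.snd.comp ht)
  have ht3 := Primrec.snd.comp (Primrec.snd.comp ht)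
  obtain ⟨d₁, hd₁⟩ := KC_le_of_card_log hU (hpairs (Primrec.fst.comp hq) Primrec.fst
    (Primrec.snd.comp hq) ht1 ht2)
  have hpow := primrec_pow.comp (Primrec.const 2) ht3
  obtain ⟨d₂, hd₂⟩ := KC_le_of_card_log hU (SigmaOne.exists_finset (hpairs (Primrec.fst.comp
    Primrec.fst) Primrec.snd (Primrec.snd.comp (hq.comp Primrec.fst)) (ht1.comp Primrec.fst)
    (ht2.comp Primrec.fst)) hpow 1)
  refine ⟨2 * d₁ + 2 * d₂ + 3, fun N x b q hb hx => ?_⟩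
  set m := KC U b (cnd ([], q)) + 1 with hm
  set l := KC U x (cnd (b, q)) + 1 with hl
  have hself : pairs x b q m l := ⟨Nat.lt_succ_self _, Nat.lt_succ_self _⟩
  let many : ℕ → Prop := fun j => ∃ S : Finset Str, 2 ^ j ≤ 1 * S.card ∧ ∀ b ∈ S, pairs x b q m l
  obtain ⟨j, hjm, hj, hmax⟩ : ∃ j ≤ m, many j ∧ ∀ i ≤ m, j < i → ¬ many i :=
    ⟨Nat.findGreatest many m, Nat.findGreatest_le _,
      Nat.findGreatest_spec (m := 0) (Nat.zero_le _) ⟨{b}, by simp, by simpa using hself⟩,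
      fun i hi hlt => Nat.findGreatest_is_greatest hlt hi⟩
  have hlog : log2 (N + 1) ≤ 2 * log2 N := log2_add_le N 1
  have e₁ : KC U b (cnd (x, q)) ≤ (j + 1) + d₁ * log2 (N + 1) := by
    refine hd₁ (N + 1) (cnd (x, q)) m l 0 (j + 1) (by omega) (by omega) (by omega) ?_ b
      (by simpa using hself)
    intro S hS
    simp only [uncnd_cnd] at hS
    by_contra! hlt
    rcases Nat.lt_or_ge m (j + 1) with h | h
    · have h1 := card_le_of_KC_lt hU S _ m fun b hb => (hS b hb).1
      have h2 : 2 ^ m ≤ 2 ^ (j + 1) := Nat.pow_le_pow_right (by norm_num) h.le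
      omega
    · exact hmax (j + 1) h (by omega) ⟨S, by omega, hS⟩
  have e₂ : KC U x (cnd ([], q)) ≤ (m + l - j) + d₂ * log2 (N + 1) := by
    refine hd₂ (N + 1) (cnd ([], q)) m l j (m + l - j) (by omega) (by omega) (by omega) ?_ x
      (by simpa only [uncnd_cnd] using hj)
    intro S hS
    simp only [uncnd_cnd, one_mul] at hS
    choose! z hz hzp using hS
    have h1 : (S.sigma z).card ≤ 2 ^ (m + l) := by
      refine card_le_of_programs (S.sigma z) m l
        (fun i p p' => i.2 ∈ U.1 (p, cnd ([], q)) ∧ i.1 ∈ U.1 (p', cnd (i.2, q))) ?_ ?_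
      · intro i hi
        rw [Finset.mem_sigma] at hi
        obtain ⟨h1, h2⟩ := hzp i.1 hi.1 i.2 hi.2
        obtain ⟨p, hp, hp'⟩ := (KC_lt_iff hU).1 h1
        obtain ⟨r, hr, hr'⟩ := (KC_lt_iff hU).1 h2
        exact ⟨p, r, hp, hr, hp', hr'⟩
      · rintro ⟨x₁, b₁⟩ _ ⟨x₂, b₂⟩ _ p r ⟨h1, h2⟩ ⟨h3, h4⟩
        obtain rfl : b₁ = b₂ := Part.mem_unique h1 h3
        obtain rfl : x₁ = x₂ := Part.mem_unique h2 h4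
        rfl
    have h2 : S.card * 2 ^ j ≤ (S.sigma z).card := by
      rw [Finset.card_sigma, ← smul_eq_mul]
      exact Finset.card_nsmul_le_sum _ _ _ hz
    have h3 : S.card * 2 ^ j ≤ 2 ^ (m + l - j) * 2 ^ j := by
      rw [← pow_add, Nat.sub_add_cancel (by omega)]
      exact h2.trans h1
    exact Nat.le_of_mul_le_mul_right h3 (by positivity)
  have f₁ := Nat.mul_le_mul_left d₁ hlog
  have f₂ := Nat.mul_le_mul_left d₂ hlog
  have := log2_pos N
  have : (2 * d₁ + 2 * d₂ + 3) * log2 N =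
    d₁ * (2 * log2 N) + d₂ * (2 * log2 N) + 3 * log2 N := by ring
  omega

/-! ### Elementary bounds -/

theorem KC_le_comp {U : CondMachine} (hU : OptimalMachine U) {F : Str → Str} (hF : Primrec F) :
    ∃ d : ℕ, ∀ x y : Str, KC U x y ≤ KC U x (F y) + d := by
  have hF' : Partrec fun q : Str × ℕ => Part.some (F q.1) :=
    Computable.partrec (hF.comp Primrec.fst).to_comp
  obtain ⟨d, hd⟩ := KC_transform hU hF' Partrec.some
  exact ⟨d, fun x y => by simpa using hd y (F y) x x 0 0 (by simp) (by simp) (by simp)⟩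

theorem KC_le_length {U : CondMachine} (hU : OptimalMachine U) :
    ∃ d : ℕ, ∀ x y : Str, KC U x y ≤ x.length + d := by
  have hV : Partrec fun q : (Str × ℕ) × Str => Part.some q.1.1 :=
    Computable.partrec (Computable.fst.comp Computable.fst)
  obtain ⟨d, hd⟩ := KC_le_of_partrec hU hV
  exact ⟨d, fun x y => by simpa using hd x 0 y x 0 (by simp) (by simp)⟩

theorem KC_le_of_program {U : CondMachine} (hU : OptimalMachine U) :
    ∃ d : ℕ, ∀ a p y : Str, a ∈ U.1 (p, []) → KC U a y ≤ KC U p y + d := by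
  have hF : Partrec fun q : Str × ℕ => Part.some q.1 := Computable.partrec Computable.fst
  have hG : Partrec fun p : Str => U.1 (p, []) :=
    U.2.comp (Computable.pair Computable.id (Computable.const []))
  obtain ⟨d, hd⟩ := KC_transform hU hF hG
  exact ⟨d, fun a p y h => by simpa using hd y y p a 0 0 (by simp) (by simp) h⟩

theorem KC_program_le {U : CondMachine} (hU : OptimalMachine U) :
    ∃ d : ℕ, ∀ x a p : Str, a ∈ U.1 (p, []) → KC U x p ≤ KC U x a + d := by
  have hF : Partrec fun q : Str × ℕ => U.1 (q.1, []) :=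
    U.2.comp (Computable.pair Computable.fst (Computable.const []))
  obtain ⟨d, hd⟩ := KC_transform hU hF Partrec.some
  exact ⟨d, fun x a p h => by simpa using hd p a x x 0 0 (by simp) h (by simp)⟩

/-- A shortest description of `a` that can be found from `a` and `C(a)`. -/
theorem exists_shortest {U : CondMachine} (hU : OptimalMachine U) :
    ∃ d : ℕ, ∀ a : Str, ∃ p : Str, p.length = KC U a [] ∧ a ∈ U.1 (p, []) ∧
      ∀ (N : ℕ) (x : Str), KC U a [] ≤ N → KC U x a ≤ KC U x p + d * log2 N := by
  have h1 : SigmaOne fun q : (Str × ℕ) × Str => q.2.length = q.1.2 :=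
    SigmaOne.of_primrecPred (Primrec.eq.comp (Primrec.list_length.comp Primrec.snd)
      (Primrec.snd.comp Primrec.fst))
  have h2 : SigmaOne fun q : (Str × ℕ) × Str => q.1.1 ∈ U.1 (q.2, []) :=
    (SigmaOne.graph U.2).comp (f := fun q : (Str × ℕ) × Str => ((q.2, []), q.1.1))
      (Primrec.pair (Primrec.pair Primrec.snd (Primrec.const []))
        (Primrec.fst.comp Primrec.fst))
  obtain ⟨f, hf, hsound, hdef⟩ := (h1.and h2).exists_partrec
  obtain ⟨d, hd⟩ := KC_transform_log hU hf
  refine ⟨d, fun a => ?_⟩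
  obtain ⟨p, hp, hap⟩ := exists_program hU a []
  obtain ⟨p', hp'⟩ := hdef (a, KC U a []) p ⟨hp, hap⟩
  obtain ⟨h3, h4⟩ := hsound _ _ hp'
  exact ⟨p', h3, h4, fun N x hN => hd N a p' x _ hN hp'⟩

/-! ### Tables of random rows -/

/-- The lists of length `k` with entries in `A`. -/
def listsOf {α : Type*} [DecidableEq α] (A : Finset α) : ℕ → Finset (List α)
  | 0 => {[]}
  | k + 1 => (A ×ˢ listsOf A k).image fun q => q.1 :: q.2

theorem mem_listsOf {α : Type*} [DecidableEq α] {A : Finset α} {k : ℕ} {l : List α} :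
    l ∈ listsOf A k ↔ l.length = k ∧ ∀ x ∈ l, x ∈ A := by
  induction k generalizing l with
  | zero => cases l <;> simp [listsOf]
  | succ k ih =>
    cases l with
    | nil => simp [listsOf]
    | cons x l => simp [listsOf, ih]; tauto

theorem card_listsOf {α : Type*} [DecidableEq α] (A : Finset α) (k : ℕ) :
    (listsOf A k).card = A.card ^ k := by
  induction k with
  | zero => simp [listsOf]
  | succ k ih =>
    rw [listsOf, Finset.card_image_of_injective, Finset.card_product, ih, pow_succ, mul_comm]
    rintro ⟨a, b⟩ ⟨c, d⟩ h
    simpa using h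

/-- The tables with `2 ^ (n + 1)` rows of length `n`. -/
def tables (n : ℕ) : Finset (List Str) := listsOf (listsOf Finset.univ n) (2 ^ (n + 1))

theorem mem_tables {n : ℕ} {R : List Str} :
    R ∈ tables n ↔ R.length = 2 ^ (n + 1) ∧ ∀ r ∈ R, r.length = n := by
  simp [tables, mem_listsOf]

theorem card_tables (n : ℕ) : (tables n).card = (2 ^ n) ^ (2 ^ (n + 1)) := by
  simp [tables, card_listsOf]

theorem card_tables_pos (n : ℕ) : 0 < (tables n).card := by
  rw [card_tables]; positivity

theorem primrecRel_mem_tables : PrimrecRel fun (n : ℕ) (R : List Str) => R ∈ tables n := by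
  have h1 : PrimrecRel fun (r : Str) (n : ℕ) => r.length = n :=
    Primrec.eq.comp (Primrec.list_length.comp Primrec.fst) Primrec.snd
  have h2 : PrimrecRel fun (n : ℕ) (R : List Str) => R.length = 2 ^ (n + 1) :=
    Primrec.eq.comp (Primrec.list_length.comp Primrec.snd)
      (primrec_pow.comp (Primrec.const 2) (Primrec.succ.comp Primrec.fst))
  exact (h2.and (h1.forall_mem_list.comp Primrec.snd Primrec.fst)).of_eq fun q => mem_tables.symm

theorem primrec_card_tables : Primrec fun n => (tables n).card :=
  (primrec_pow.comp (primrec_pow.comp (Primrec.const 2) Primrec.id)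
    (primrec_pow.comp (Primrec.const 2) Primrec.succ)).of_eq fun n => (card_tables n).symm

/-- Most tables do not help to describe a given string. -/
theorem card_informative_tables {U : CondMachine} (hU : OptimalMachine U) :
    ∃ d : ℕ, ∀ (N n : ℕ) (w s : Str), n ≤ N → KC U w (cnd (s, [], [], [])) ≤ N →
      8 * ((tables n).filter fun R => KC U w (cnd (s, R, [], [])) + d * log2 N <
        KC U w (cnd (s, [], [], []))).card < (tables n).card := by
  classical
  have ht : Primrec fun p : (Str × Str × (ℕ × ℕ × ℕ)) × List Str => p.1.2.2 :=
    Primrec.snd.comp (Primrec.snd.comp Primrec.fst)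
  have h1 : SigmaOne fun p : (Str × Str × (ℕ × ℕ × ℕ)) × List Str => p.2 ∈ tables p.1.2.2.1 :=
    SigmaOne.of_primrecPred (primrecRel_mem_tables.comp (Primrec.fst.comp ht) Primrec.snd)
  have h2 : SigmaOne fun p : (Str × Str × (ℕ × ℕ × ℕ)) × List Str =>
      KC U p.1.1 (cnd ((uncnd p.1.2.1).1, p.2, [], [])) < p.1.2.2.2.1 := by
    refine SigmaOne.KC_lt hU (Primrec.fst.comp Primrec.fst) (primrec_cnd.comp ?_)
      (Primrec.fst.comp (Primrec.snd.comp ht))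
    exact Primrec.pair (Primrec.fst.comp (primrec_uncnd.comp
      (Primrec.fst.comp (Primrec.snd.comp Primrec.fst))))
      (Primrec.pair Primrec.snd (Primrec.const ([], [])))
  obtain ⟨d, hd⟩ := KC_le_of_card_log hU (SigmaOne.exists_finset (h1.and h2)
    (primrec_card_tables.comp (Primrec.fst.comp (Primrec.snd.comp Primrec.snd))) 8)
  refine ⟨d + 4, fun N n w s hn hw => ?_⟩
  have hpos := card_tables_pos n
  have hlog := log2_pos N
  set k := KC U w (cnd (s, [], [], [])) with hk
  by_contra! hle
  rcases Nat.lt_or_ge k ((d + 4) * log2 N) with hsmall | hbig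
  · rw [Finset.filter_false_of_mem] at hle
    · rw [Finset.card_empty] at hle
      omega
    · intro R _
      omega
  have hbound := hd N (cnd (s, [], [], [])) n (k - (d + 4) * log2 N) 0
    (k - (d + 4) * log2 N + 3) hn (by omega) (by omega) ?_ w ⟨_, hle, ?_⟩
  · have : (d + 4) * log2 N = d * log2 N + 4 * log2 N := by ring
    omega
  · intro S hS
    simp only [uncnd_cnd] at hS
    choose! T hT hTmem using hS
    have hTsub : ∀ x ∈ S, T x ⊆ tables n := fun x hx R hR => (hTmem x hx R hR).1
    have e1 : S.card * (tables n).card ≤ ∑ x ∈ S, 8 * (T x).card := by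
      rw [← smul_eq_mul]
      exact Finset.card_nsmul_le_sum _ _ _ hT
    have e2 : ∑ x ∈ S, (T x).card =
        ∑ R ∈ tables n, (S.filter fun x => R ∈ T x).card := by
      have := Finset.sum_card_bipartiteAbove_eq_sum_card_bipartiteBelow
        (s := S) (t := tables n) (fun x R => R ∈ T x)
      refine Eq.trans (Finset.sum_congr rfl fun x hx => ?_) this
      congr 1
      ext R
      simp only [Finset.bipartiteAbove, Finset.mem_filter]
      exact ⟨fun h => ⟨hTsub x hx h, h⟩, fun h => h.2⟩
    have e3 : ∑ R ∈ tables n, (S.filter fun x => R ∈ T x).card ≤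
        (tables n).card * 2 ^ (k - (d + 4) * log2 N) := by
      rw [← smul_eq_mul]
      refine Finset.sum_le_card_nsmul _ _ _ fun R _ => ?_
      refine card_le_of_KC_lt hU _ (cnd (s, R, [], [])) _ fun x hx => ?_
      rw [Finset.mem_filter] at hx
      exact (hTmem x hx.1 R hx.2).2
    rw [← Finset.mul_sum, e2] at e1
    have e4 : S.card * (tables n).card ≤
        2 ^ (k - (d + 4) * log2 N + 3) * (tables n).card := by
      rw [pow_add]
      nlinarith
    exact Nat.le_of_mul_le_mul_right e4 hpos
  · intro R hR
    rw [Finset.mem_filter] at hR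
    refine ⟨hR.1, ?_⟩
    simp only [uncnd_cnd]
    omega

/-- The row of the table `R` attached to the string `s`. -/
def row (R : List Str) (s : Str) : Str := R.getD (strIdx s) []

/-- The row attached to `s`, followed by `s` itself. -/
def tag (R : List Str) (s : Str) : Str := row R s ++ s

theorem primrec_tag : Primrec₂ tag := by
  have h : Primrec fun q : List Str × Str => strIdx q.2 :=
    primrec_binVal.comp (Primrec.list_cons.comp (Primrec.const true) Primrec.snd)
  exact Primrec.list_append.comp ((Primrec.list_getD []).comp Primrec.fst h) Primrec.snd

theorem strIdx_lt_length {n : ℕ} {R : List Str} (hR : R ∈ tables n) {s : Str}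
    (hs : s.length ≤ n) : strIdx s < R.length := by
  rw [(mem_tables.1 hR).1]
  exact strIdx_lt (by omega)

theorem length_row {n : ℕ} {R : List Str} (hR : R ∈ tables n) {s : Str} (hs : s.length ≤ n) :
    (row R s).length = n := by
  have h := strIdx_lt_length hR hs
  rw [row, List.getD_eq_getElem _ _ h]
  exact (mem_tables.1 hR).2 _ (List.getElem_mem h)

/-- Few tables attach to two strings rows with the same prefix of length `u`. -/
theorem card_collision_mul_le {n u : ℕ} (hu : u ≤ n) {s t : Str} (hs : s.length ≤ n) (hst : s ≠ t) :
    ((tables n).filter fun R => (row R s).take u = (row R t).take u).card * 2 ^ u ≤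
      (tables n).card := by
  classical
  have hcard : 2 ^ u = (listsOf (Finset.univ : Finset Bool) u).card := by simp [card_listsOf]
  have hne : strIdx s ≠ strIdx t := fun h => hst (strIdx_injective h)
  rw [hcard, ← Finset.card_product]
  refine Finset.card_le_card_of_injOn
    (fun q => q.1.set (strIdx s) (q.2 ++ (row q.1 s).drop u)) ?_ ?_
  · rintro ⟨R, w⟩ hq
    simp only [Finset.coe_product, Set.mem_prod, Finset.mem_coe, Finset.mem_filter,
      mem_listsOf] at hq
    obtain ⟨⟨hR, _⟩, hw, _⟩ := hq
    have hlen := length_row hR hs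
    rw [Finset.mem_coe, mem_tables]
    refine ⟨by simpa using (mem_tables.1 hR).1, fun r hr => ?_⟩
    rcases List.mem_or_eq_of_mem_set hr with h | rfl
    · exact (mem_tables.1 hR).2 r h
    · simp only [List.length_append, List.length_drop]
      omega
  · rintro ⟨R, w⟩ hq ⟨R', w'⟩ hq' he
    simp only [Finset.coe_product, Set.mem_prod, Finset.mem_coe, Finset.mem_filter,
      mem_listsOf] at hq hq'
    obtain ⟨⟨hR, hc⟩, hw, _⟩ := hq
    obtain ⟨⟨hR', hc'⟩, hw', _⟩ := hq'
    simp only at he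
    have hi := strIdx_lt_length hR hs
    have hi' := strIdx_lt_length hR' hs
    have hget : ∀ i, i ≠ strIdx s → R[i]? = R'[i]? := fun i hi => by
      have := congrArg (fun l : List Str => l[i]?) he
      simpa [List.getElem?_set_ne hi.symm] using this
    have hrow : w ++ (row R s).drop u = w' ++ (row R' s).drop u := by
      have := congrArg (fun l : List Str => l[strIdx s]?) he
      simpa [List.getElem?_set_self hi, List.getElem?_set_self hi'] using this
    obtain ⟨h1, h2⟩ := List.append_inj hrow (by omega)
    have hrt : row R t = row R' t := by
      simp [row, List.getD_eq_getElem?_getD, hget _ hne.symm]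
    have hrs : row R s = row R' s := by
      rw [← List.take_append_drop u (row R s), hc, hrt, ← hc', h2, List.take_append_drop]
    refine Prod.ext (List.ext_getElem? fun i => ?_) h1
    by_cases h : i = strIdx s
    · subst h
      rw [row, row, List.getD_eq_getElem _ _ hi, List.getD_eq_getElem _ _ hi'] at hrs
      simp only [List.getElem?_eq_getElem hi, List.getElem?_eq_getElem hi', hrs]
    · exact hget i h

/-- For most tables, a short prefix of the tag of `p` is nearly as informative about `p` as
its length allows. -/
theorem exists_few_colliding_tables {U : CondMachine} (hU : OptimalMachine U) :
    ∃ d : ℕ, ∀ (n : ℕ) (p b : Str), p.length ≤ n →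
      ∃ bad : Finset (List Str), 8 * bad.card < (tables n).card ∧
        ∀ R ∈ tables n, R ∉ bad → ∀ u : ℕ,
          KC U p (cnd (b, R, (tag R p).take u, [])) ≤ (KC U p b - u) + d * log2 n := by
  classical
  obtain ⟨d₀, hd₀⟩ := KC_le_length hU
  have hy : Primrec fun q : Str × Str × (ℕ × ℕ × ℕ) => uncnd q.2.1 :=
    primrec_uncnd.comp (Primrec.fst.comp Primrec.snd)
  have hx : Primrec fun q : Str × Str × (ℕ × ℕ × ℕ) => (uncnd q.2.1).2.2.1 :=
    Primrec.fst.comp (Primrec.snd.comp (Primrec.snd.comp hy))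
  have ht : Primrec fun q : Str × Str × (ℕ × ℕ × ℕ) => q.2.2 := Primrec.snd.comp Primrec.snd
  have h1 : SigmaOne fun q : Str × Str × (ℕ × ℕ × ℕ) => q.1.length ≤ q.2.2.1 ∧
      (uncnd q.2.1).2.2.1 = (tag (uncnd q.2.1).2.1 q.1).take (uncnd q.2.1).2.2.1.length :=
    SigmaOne.of_primrecPred ((Primrec.nat_le.comp (Primrec.list_length.comp Primrec.fst)
      (Primrec.fst.comp ht)).and (Primrec.eq.comp hx (Primrec.list_take.comp
        (Primrec.list_length.comp hx)
        (primrec_tag.comp (Primrec.fst.comp (Primrec.snd.comp hy)) Primrec.fst))))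
  have h2 : SigmaOne fun q : Str × Str × (ℕ × ℕ × ℕ) =>
      KC U q.1 (uncnd q.2.1).1 < q.2.2.2.1 :=
    SigmaOne.KC_lt hU Primrec.fst (Primrec.fst.comp hy) (Primrec.fst.comp (Primrec.snd.comp ht))
  obtain ⟨d₁, hd₁⟩ := KC_le_of_card_log hU (h1.and h2)
  refine ⟨d₀ + 7 + d₁ * (d₀ + 2), fun n p b hp => ?_⟩
  set k := KC U p b with hk
  have hkn : k ≤ n + d₀ := (hd₀ p b).trans (by omega)
  let S₀ : Finset Str := ((Finset.range (n + 1)).biUnion fun i => listsOf Finset.univ i).filter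
    fun s => KC U s b < k + 1
  have hS₀ : ∀ s, s ∈ S₀ ↔ s.length ≤ n ∧ KC U s b < k + 1 := by
    intro s
    simp [S₀, mem_listsOf]
  have hS₀card : S₀.card ≤ 2 ^ (k + 1) := card_le_of_KC_lt hU S₀ b _ fun s hs => ((hS₀ s).1 hs).2
  let coll : List Str → ℕ → Finset Str := fun R u =>
    (S₀.erase p).filter fun s => (row R s).take u = (row R p).take u
  let M : ℕ := 2 ^ (k + 1 + (log2 n + 4))
  let badAt : ℕ → Finset (List Str) := fun u =>
    (tables n).filter fun R => M ≤ (coll R u).card * 2 ^ u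
  have hT := card_tables_pos n
  have hbadAt : ∀ u ≤ n, (badAt u).card * 2 ^ (log2 n + 4) ≤ (tables n).card := by
    intro u hu
    have e1 : (badAt u).card * M ≤ ∑ R ∈ tables n, (coll R u).card * 2 ^ u := by
      rw [← smul_eq_mul]
      refine (Finset.card_nsmul_le_sum _ _ _ fun R hR => (Finset.mem_filter.1 hR).2).trans ?_
      exact Finset.sum_le_sum_of_subset (Finset.filter_subset _ _)
    have e2 : ∑ R ∈ tables n, (coll R u).card =
        ∑ s ∈ S₀.erase p,
          ((tables n).filter fun R => (row R s).take u = (row R p).take u).card :=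
      Finset.sum_card_bipartiteAbove_eq_sum_card_bipartiteBelow
        (s := tables n) (t := S₀.erase p) fun R s => (row R s).take u = (row R p).take u
    have e3 : ∑ s ∈ S₀.erase p, ((tables n).filter fun R =>
        (row R s).take u = (row R p).take u).card * 2 ^ u ≤ S₀.card * (tables n).card := by
      rw [← smul_eq_mul]
      refine (Finset.sum_le_card_nsmul _ _ (tables n).card fun s hs => ?_).trans
        (Nat.mul_le_mul_right _ (Finset.card_le_card (Finset.erase_subset _ _)))
      rw [Finset.mem_erase] at hs
      exact card_collision_mul_le hu ((hS₀ s).1 hs.2).1 hs.1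
    rw [← Finset.sum_mul, e2, Finset.sum_mul] at e1
    have e4 : 2 ^ (k + 1) * ((badAt u).card * 2 ^ (log2 n + 4)) ≤
        2 ^ (k + 1) * (tables n).card := by
      calc 2 ^ (k + 1) * ((badAt u).card * 2 ^ (log2 n + 4)) = (badAt u).card * M := by
            simp only [M]; rw [pow_add 2 (k + 1)]; ring
        _ ≤ S₀.card * (tables n).card := e1.trans e3
        _ ≤ _ := Nat.mul_le_mul_right _ hS₀card
    exact Nat.le_of_mul_le_mul_left e4 (by positivity)
  refine ⟨(Finset.range (n + 1)).biUnion badAt, ?_, fun R hR hgood u => ?_⟩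
  · set bad := (Finset.range (n + 1)).biUnion badAt
    have e1 : bad.card * 2 ^ (log2 n + 4) ≤ (n + 1) * (tables n).card := by
      calc bad.card * 2 ^ (log2 n + 4)
          ≤ (∑ u ∈ Finset.range (n + 1), (badAt u).card) * 2 ^ (log2 n + 4) :=
            Nat.mul_le_mul_right _ Finset.card_biUnion_le
        _ = ∑ u ∈ Finset.range (n + 1), (badAt u).card * 2 ^ (log2 n + 4) := Finset.sum_mul ..
        _ ≤ (Finset.range (n + 1)).card • (tables n).card :=
            Finset.sum_le_card_nsmul _ _ _ fun u hu => hbadAt u (by simp at hu; omega)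
        _ = (n + 1) * (tables n).card := by simp
    have e2 := lt_two_pow_log2 n
    have e3 : 2 ^ (log2 n + 4) = 8 * 2 ^ (log2 n + 1) := by rw [pow_add, pow_add]; ring
    rw [e3] at e1
    by_contra! hle
    have e4 : (tables n).card * 2 ^ (log2 n + 1) ≤ (tables n).card * (n + 1) := by
      nlinarith [Nat.mul_le_mul_right (2 ^ (log2 n + 1)) hle]
    have := Nat.le_of_mul_le_mul_left e4 hT
    omega
  · set v := min u n with hv
    have hcoll : (coll R v).card * 2 ^ v < M := by
      by_contra! hle
      exact hgood (Finset.mem_biUnion.2 ⟨v, by simp [hv], Finset.mem_filter.2 ⟨hR, hle⟩⟩)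
    have hcoll' : (coll R v).card ≤ 2 ^ (k + 1 + (log2 n + 4) - v) := by
      rcases le_total v (k + 1 + (log2 n + 4)) with h | h
      · refine Nat.le_of_mul_le_mul_right (c := 2 ^ v) ?_ (by positivity)
        rw [← pow_add, Nat.sub_add_cancel h]
        exact hcoll.le
      · have : M ≤ 2 ^ v := Nat.pow_le_pow_right (by norm_num) h
        have : (coll R v).card < 1 := by
          by_contra! h1
          nlinarith
        exact (Nat.lt_one_iff.1 this).trans_le (Nat.zero_le _)
    have hlog := log2_add_le n (d₀ + 1)
    have := hd₁ (n + (d₀ + 1)) (cnd (b, R, (tag R p).take u, [])) n (k + 1) 0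
      (k + 1 + (log2 n + 4) - v + 1) (by omega) (by omega) (by omega) ?_ p ?_
    · have f1 := Nat.mul_le_mul_left d₁ hlog
      have f2 : (d₀ + 7 + d₁ * (d₀ + 2)) * log2 n =
          d₀ * log2 n + 7 * log2 n + d₁ * ((d₀ + 2) * log2 n) := by ring
      have f3 := log2_pos n
      have f4 : d₀ ≤ d₀ * log2 n := Nat.le_mul_of_pos_right _ f3
      have f5 : d₀ + 1 + 1 = d₀ + 2 := rfl
      rw [f5] at f1
      omega
    · intro S hS
      simp only [uncnd_cnd] at hS
      have hsub : S ⊆ insert p (coll R v) := by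
        intro s hs
        obtain ⟨⟨hsn, hpre⟩, hC⟩ := hS s hs
        rw [Finset.mem_insert]
        by_cases hsp : s = p
        · exact Or.inl hsp
        · refine Or.inr (Finset.mem_filter.2 ⟨Finset.mem_erase.2 ⟨hsp, (hS₀ s).2 ⟨hsn, hC⟩⟩, ?_⟩)
          have g1 := length_row hR hp
          have g2 := length_row hR hsn
          have g3 := congrArg (List.take v) hpre
          rw [List.take_take, List.take_take, List.length_take] at g3
          have g4 : v ≤ min u (tag R p).length := by simp [tag, g1, hv]
          rw [min_eq_left (by omega : v ≤ u), min_eq_left g4, tag, tag,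
            List.take_append_of_le_length (by omega),
            List.take_append_of_le_length (by omega)] at g3
          exact g3.symm
      have g := (Finset.card_le_card hsub).trans (Finset.card_insert_le _ _)
      rw [pow_succ]
      have : 1 ≤ 2 ^ (k + 1 + (log2 n + 4) - v) := Nat.one_le_two_pow
      omega
    · simp only [uncnd_cnd]
      exact ⟨⟨hp, by rw [List.length_take, List.take_eq_take_iff]; simp⟩, by omega⟩

/-! ### Conditional complexities relative to a prefix of a tag -/

theorem KC_le_add_length {U : CondMachine} (hU : OptimalMachine U) :
    ∃ d : ℕ, ∀ (N u : ℕ) (p x : Str) (R : List Str), x.length ≤ u → u ≤ N →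
      KC U p (cnd ([], R, x, [])) ≤ N →
      KC U p (cnd ([], R, [], [])) ≤ KC U p (cnd ([], R, x, [])) + u + d * log2 N := by
  have ht : Primrec fun q : (Str × Str × (ℕ × ℕ × ℕ)) × Str => q.1.2.2 :=
    Primrec.snd.comp (Primrec.snd.comp Primrec.fst)
  have h1 : SigmaOne fun q : (Str × Str × (ℕ × ℕ × ℕ)) × Str => q.2.length < q.1.2.2.2.1 :=
    SigmaOne.of_primrecPred (Primrec.nat_lt.comp (Primrec.list_length.comp Primrec.snd)
      (Primrec.fst.comp (Primrec.snd.comp ht)))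
  have h2 : SigmaOne fun q : (Str × Str × (ℕ × ℕ × ℕ)) × Str =>
      KC U q.1.1 (cnd ([], (uncnd q.1.2.1).2.1, q.2, [])) < q.1.2.2.1 := by
    refine SigmaOne.KC_lt hU (Primrec.fst.comp Primrec.fst) (primrec_cnd.comp ?_)
      (Primrec.fst.comp ht)
    exact Primrec.pair (Primrec.const []) (Primrec.pair (Primrec.fst.comp (Primrec.snd.comp
      (primrec_uncnd.comp (Primrec.fst.comp (Primrec.snd.comp Primrec.fst)))))
      (Primrec.pair Primrec.snd (Primrec.const [])))
  obtain ⟨d, hd⟩ := KC_le_of_card_log hU (h1.and h2).exists_snd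
  refine ⟨2 * d + 2, fun N u p x R hx hu hN => ?_⟩
  set k := KC U p (cnd ([], R, x, [])) with hk
  have h := hd (N + 1) (cnd ([], R, [], [])) (k + 1) (u + 1) 0 (k + 1 + (u + 1)) (by omega)
    (by omega) (by omega) ?_ p ⟨x, Nat.lt_succ_of_le hx, by simp [← hk]⟩
  · have h1 := log2_pos N
    have h2 := Nat.mul_le_mul_left d (log2_add_le N 1)
    have h3 : (2 * d + 2) * log2 N = d * ((1 + 1) * log2 N) + 2 * log2 N := by ring
    omega
  · intro S hS
    simp only [uncnd_cnd] at hS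
    refine card_le_of_programs S (k + 1) (u + 1) (fun s r z => s ∈ U.1 (r, cnd ([], R, z, [])))
      ?_ ?_
    · intro s hs
      obtain ⟨z, hz, hz'⟩ := hS s hs
      obtain ⟨r, hr, hr'⟩ := (KC_lt_iff hU).1 hz'
      exact ⟨r, z, hr, hz, hr'⟩
    · intro s _ s' _ r z h h'
      exact Part.mem_unique h h'

theorem KC_le_tag_take {U : CondMachine} (hU : OptimalMachine U) :
    ∃ d : ℕ, ∀ (N u : ℕ) (x p : Str) (R : List Str), u ≤ N →
      KC U x (cnd (p, R, [], [])) ≤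
        KC U x (cnd (p, R, (tag R p).take u, [])) + d * log2 N := by
  have hy : Primrec fun q : Str × ℕ => uncnd q.1 := primrec_uncnd.comp Primrec.fst
  have hR := Primrec.fst.comp (Primrec.snd.comp hy)
  have hF : Primrec fun q : Str × ℕ => cnd ((uncnd q.1).1, (uncnd q.1).2.1,
      (tag (uncnd q.1).2.1 (uncnd q.1).1).take q.2, []) :=
    primrec_cnd.comp (Primrec.pair (Primrec.fst.comp hy) (Primrec.pair hR
      (Primrec.pair (Primrec.list_take.comp Primrec.snd
        (primrec_tag.comp hR (Primrec.fst.comp hy))) (Primrec.const []))))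
  obtain ⟨d, hd⟩ := KC_transform_log hU (Computable.partrec hF.to_comp)
  exact ⟨d, fun N u x p R hu => hd N _ _ x u hu (by simp)⟩

/-- For most tables, a prefix of the tag of a shortest description of `a` is about `b` no more
informative than it has to be, given how informative it is about `a`. -/
theorem exists_few_bad_tables {U : CondMachine} (hU : OptimalMachine U) :
    ∃ D : ℕ, ∀ (a b : Str) (n : ℕ), KC U a [] + KC U b [] ≤ n →
      ∃ p : Str, p.length = KC U a [] ∧ a ∈ U.1 (p, []) ∧
        ∃ bad : Finset (List Str), 8 * bad.card < 3 * (tables n).card ∧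
          ∀ R ∈ tables n, R ∉ bad → ∀ u ≤ 2 * n,
            min (KC U b []) (KC U a (cnd ([], R, (tag R p).take u, [])) + KC U b a) ≤
              KC U b (cnd ([], R, (tag R p).take u, [])) + D * log2 n := by
  classical
  obtain ⟨cLen, hLen⟩ := KC_le_length hU
  obtain ⟨cProg, hProg⟩ := KC_le_of_program hU
  obtain ⟨cProg', hProg'⟩ := KC_program_le hU
  obtain ⟨cShort, hShort⟩ := exists_shortest hU
  obtain ⟨cSym, hSym⟩ := symmetry_of_information hU
  obtain ⟨cInf, hInf⟩ := card_informative_tables hU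
  obtain ⟨cColl, hColl⟩ := exists_few_colliding_tables hU
  obtain ⟨cAdd, hAdd⟩ := KC_le_add_length hU
  obtain ⟨cTag, hTag⟩ := KC_le_tag_take hU
  obtain ⟨cNil, hNil⟩ := KC_le_comp hU (F := fun _ => []) (Primrec.const [])
  obtain ⟨cIn, hIn⟩ := KC_le_comp hU (F := fun y => cnd (y, [], [], []))
    (primrec_cnd.comp (Primrec.pair Primrec.id (Primrec.const _)))
  obtain ⟨cOut, hOut⟩ := KC_le_comp hU (F := fun y => (uncnd y).1)
    (Primrec.fst.comp primrec_uncnd)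
  have hOut' : ∀ x s, KC U x (cnd (s, [], [], [])) ≤ KC U x s + cOut := fun x s => by
    simpa using hOut x (cnd (s, [], [], []))
  let e := cLen + cNil
  let E := e + 2
  refine ⟨cLen + cProg + cProg' + cShort + 2 * (cSym * E) + 2 * (cInf * E) + cColl + cAdd * E
    + cTag * E + cNil + 2 * cIn + 3 * cOut, fun a b n hn => ?_⟩
  obtain ⟨p, hpl, hap, hsh⟩ := hShort a
  obtain ⟨badC, hbadC, hC⟩ := hColl n p b (by omega)
  have hlen : ∀ y, KC U p y ≤ 2 * n + e := fun y => (hLen p y).trans (by omega)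
  have hlenb : ∀ y, KC U b y ≤ 2 * n + e := fun y => (hNil b y).trans (by omega)
  have hlog : ∀ c, c * log2 (2 * n + e) ≤ c * E * log2 n := fun c => by
    rw [mul_assoc]
    exact Nat.mul_le_mul_left c (log2_two_mul_add_le n e)
  refine ⟨p, hpl, hap, badC ∪ ((tables n).filter (fun R => KC U b (cnd (p, R, [], [])) +
      cInf * log2 (2 * n + e) < KC U b (cnd (p, [], [], []))) ∪
    (tables n).filter fun R => KC U p (cnd ([], R, [], [])) + cInf * log2 (2 * n + e) <
        KC U p (cnd ([], [], [], []))), ?_, ?_⟩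
  · have h1 := hInf (2 * n + e) n b p (by omega) (hlenb _)
    have h2 := hInf (2 * n + e) n p [] (by omega) (hlen _)
    refine lt_of_le_of_lt (Nat.mul_le_mul_left 8 ((Finset.card_union_le _ _).trans
      (Nat.add_le_add_left (Finset.card_union_le _ _) _))) ?_
    omega
  · intro R hR hgood u hu
    simp only [Finset.mem_union, Finset.mem_filter, not_or, not_and, not_lt] at hgood
    obtain ⟨hg1, hg2, hg3⟩ := hgood
    have g2 := hg2 hR
    have g3 := hg3 hR
    set x := (tag R p).take u with hx
    have hxu : x.length ≤ u := by simp [hx]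
    have i1 := hSym (2 * n + e) p b (R, x, []) (hlenb _) (hlen _)
    have i2 := hTag (2 * n + e) u b p R (by omega)
    have i3 := hIn b p
    have i4 := hsh n b (by omega)
    have i5 := hC R hR hg1 u
    have i6 := hProg a p (cnd ([], R, x, [])) hap
    have i7 := hAdd (2 * n + e) u p x R hxu (by omega) (hlen _)
    have i8 := hProg a p [] hap
    have i9 := hIn p []
    have i10 := hSym (2 * n + e) b p ([], [], []) (hlen _) (hlenb _)
    have i11 := hProg' b a p hap
    have i12 := hLen p []
    have i13 := hIn b []
    have i14 := hOut' p []
    have i15 := hOut' b p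
    have i16 : KC U p b ≤ KC U p (cnd (b, [], [], [])) + cIn := hIn p b
    rw [← hx] at i2 i5
    have l1 := hlog cSym
    have l2 := hlog cInf
    have l3 := hlog cAdd
    have l4 := hlog cTag
    have hL := log2_pos n
    have m : ∀ c, c ≤ c * log2 n := fun c => Nat.le_mul_of_pos_right c hL
    have m1 := m cLen
    have m2 := m cProg
    have m3 := m cProg'
    have m4 := m cNil
    have m5 := m cIn
    have m6 := m cOut
    rw [show (cLen + cProg + cProg' + cShort + 2 * (cSym * E) + 2 * (cInf * E) + cColl + cAdd * E
      + cTag * E + cNil + 2 * cIn + 3 * cOut) * log2 n = cLen * log2 n + cProg * log2 n +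
      cProg' * log2 n + cShort * log2 n + 2 * (cSym * E * log2 n) + 2 * (cInf * E * log2 n) +
      cColl * log2 n + cAdd * E * log2 n + cTag * E * log2 n + cNil * log2 n +
      2 * (cIn * log2 n) + 3 * (cOut * log2 n) by ring]
    generalize cLen * log2 n = X1 at *
    generalize cProg * log2 n = X2 at *
    generalize cProg' * log2 n = X3 at *
    generalize cShort * log2 n = X4 at *
    generalize cSym * E * log2 n = X5 at *
    generalize cInf * E * log2 n = X6 at *
    generalize cColl * log2 n = X7 at *
    generalize cAdd * E * log2 n = X8 at *
    generalize cTag * E * log2 n = X9 at *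
    generalize cSym * log2 (2 * n + e) = Y5 at *
    generalize cInf * log2 (2 * n + e) = Y6 at *
    generalize cAdd * log2 (2 * n + e) = Y8 at *
    generalize cTag * log2 (2 * n + e) = Y9 at *
    rcases Nat.lt_or_ge u (KC U p b) with h | h
    · refine (min_le_left _ _).trans ?_
      omega
    · refine (min_le_right _ _).trans ?_
      omega

/-! ### A discrete intermediate value theorem on a grid -/

/-- The number modulo two of changes between the colours `0` and `1` along an edge. -/
def colourFlip (a b : Fin 3) : ZMod 2 := if (a = 0 ∧ b = 1) ∨ (a = 1 ∧ b = 0) then 1 else 0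

theorem sum_range_add_succ_zmod_two (x : ℕ → ZMod 2) (P : ℕ) :
    ∑ i ∈ Finset.range P, (x i + x (i + 1)) = x 0 + x P := by
  have h := Finset.sum_range_sub x P
  simp only [CharTwo.sub_eq_add] at h
  rw [add_comm (x 0), ← h]
  exact Finset.sum_congr rfl fun i _ => add_comm _ _

/-- A three-colouring of a grid whose sides avoid the colours `1`, `0`, `2`, `2` has a cell with
all three colours. -/
theorem exists_three_coloured_cell (P Q : ℕ) (col : ℕ → ℕ → Fin 3)
    (hbottom : ∀ u ≤ P, col u 0 ≠ 1) (hleft : ∀ v ≤ Q, col 0 v ≠ 0)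
    (hright : ∀ v ≤ Q, col P v ≠ 2) (htop : ∀ u ≤ P, col u Q ≠ 2) :
    ∃ u < P, ∃ v < Q, ∀ c : Fin 3,
      col u v = c ∨ col (u + 1) v = c ∨ col (u + 1) (v + 1) = c ∨ col u (v + 1) = c := by
  by_contra! hno
  have hcell : ∀ p q r s : Fin 3, (∃ c, p ≠ c ∧ q ≠ c ∧ r ≠ c ∧ s ≠ c) →
      (colourFlip p q + colourFlip s r) + (colourFlip p s + colourFlip q r) = 0 := by
    decide
  have hnoY : ∀ p q : Fin 3, p ≠ 1 → q ≠ 1 → colourFlip p q = 0 := by decide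
  have hnoX : ∀ p q : Fin 3, p ≠ 0 → q ≠ 0 → colourFlip p q = 0 := by decide
  have hnoZ : ∀ p q : Fin 3, p ≠ 2 → q ≠ 2 →
      colourFlip p q = (if p = 0 then 1 else 0) + (if q = 0 then 1 else 0) := by
    decide
  have htotal : ∑ u ∈ Finset.range P, ∑ v ∈ Finset.range Q,
      ((colourFlip (col u v) (col (u + 1) v) + colourFlip (col u (v + 1)) (col (u + 1) (v + 1))) +
        (colourFlip (col u v) (col u (v + 1)) +
          colourFlip (col (u + 1) v) (col (u + 1) (v + 1)))) = 0 :=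
    Finset.sum_eq_zero fun u hu => Finset.sum_eq_zero fun v hv =>
      hcell _ _ _ _ (hno u (Finset.mem_range.1 hu) v (Finset.mem_range.1 hv))
  simp only [Finset.sum_add_distrib (f := fun v => colourFlip _ _ + colourFlip _ _)] at htotal
  rw [Finset.sum_add_distrib] at htotal
  have h1 : ∀ u, ∑ v ∈ Finset.range Q, (colourFlip (col u v) (col (u + 1) v) +
      colourFlip (col u (v + 1)) (col (u + 1) (v + 1))) =
        colourFlip (col u 0) (col (u + 1) 0) + colourFlip (col u Q) (col (u + 1) Q) := fun u =>
    sum_range_add_succ_zmod_two (fun v => colourFlip (col u v) (col (u + 1) v)) Q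
  have h2 : ∑ u ∈ Finset.range P, ∑ v ∈ Finset.range Q,
      (colourFlip (col u v) (col u (v + 1)) + colourFlip (col (u + 1) v) (col (u + 1) (v + 1))) =
        ∑ v ∈ Finset.range Q,
          (colourFlip (col 0 v) (col 0 (v + 1)) + colourFlip (col P v) (col P (v + 1))) := by
    rw [Finset.sum_comm]
    exact Finset.sum_congr rfl fun v _ =>
      sum_range_add_succ_zmod_two (fun u => colourFlip (col u v) (col u (v + 1))) P
  have h3 : ∑ u ∈ Finset.range P, (colourFlip (col u 0) (col (u + 1) 0) +
      colourFlip (col u Q) (col (u + 1) Q)) =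
        (if col 0 Q = 0 then 1 else 0) + (if col P Q = 0 then 1 else 0) := by
    rw [← sum_range_add_succ_zmod_two (fun u => if col u Q = 0 then 1 else 0) P]
    refine Finset.sum_congr rfl fun u hu => ?_
    rw [Finset.mem_range] at hu
    rw [hnoY _ _ (hbottom u hu.le) (hbottom (u + 1) hu), zero_add,
      hnoZ _ _ (htop u hu.le) (htop (u + 1) hu)]
  have h4 : ∑ v ∈ Finset.range Q, (colourFlip (col 0 v) (col 0 (v + 1)) +
      colourFlip (col P v) (col P (v + 1))) =
        (if col P 0 = 0 then 1 else 0) + (if col P Q = 0 then 1 else 0) := by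
    rw [← sum_range_add_succ_zmod_two (fun v => if col P v = 0 then 1 else 0) Q]
    refine Finset.sum_congr rfl fun v hv => ?_
    rw [Finset.mem_range] at hv
    rw [hnoX _ _ (hleft v hv.le) (hleft (v + 1) hv), zero_add,
      hnoZ _ _ (hright v hv.le) (hright (v + 1) hv)]
  simp only [h1] at htotal
  rw [h2, h3, h4, if_neg (hleft Q le_rfl)] at htotal
  have hcorner : col P 0 = 0 := by
    have e1 := hbottom P le_rfl
    have e2 := hright 0 (Nat.zero_le _)
    revert e1 e2
    generalize col P 0 = c
    revert c
    decide
  rw [if_pos hcorner] at htotal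
  split_ifs at htotal <;> revert htotal <;> decide

theorem exists_near_zero (P Q L : ℕ) (f g : ℕ → ℕ → ℤ)
    (hfu : ∀ u v, |f (u + 1) v - f u v| ≤ L) (hfv : ∀ u v, |f u (v + 1) - f u v| ≤ L)
    (hgu : ∀ u v, |g (u + 1) v - g u v| ≤ L) (hgv : ∀ u v, |g u (v + 1) - g u v| ≤ L)
    (hbottom : ∀ u ≤ P, g u 0 < 0 → f u 0 ≤ g u 0) (hleft : ∀ v ≤ Q, f 0 v < 0 → g 0 v < f 0 v)
    (hright : ∀ v ≤ Q, f P v < 0) (htop : ∀ u ≤ P, g u Q < 0) :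
    ∃ u ≤ P, ∃ v ≤ Q, |f u v| ≤ 2 * L ∧ |g u v| ≤ 2 * L := by
  let col : ℕ → ℕ → Fin 3 := fun u v =>
    if 0 ≤ f u v ∧ 0 ≤ g u v then 2 else if f u v ≤ g u v then 0 else 1
  have col0 : ∀ u v, col u v = 0 → f u v < 0 ∧ f u v ≤ g u v := by
    intro u v h
    simp only [col] at h
    split_ifs at h with h1 h2
    · exact absurd h (by decide)
    · exact ⟨by by_contra! h3; exact h1 ⟨h3, h3.trans h2⟩, h2⟩
    · exact absurd h (by decide)
  have col1 : ∀ u v, col u v = 1 → g u v < 0 ∧ g u v < f u v := by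
    intro u v h
    simp only [col] at h
    split_ifs at h with h1 h2
    · exact absurd h (by decide)
    · exact absurd h (by decide)
    · push Not at h2
      exact ⟨by by_contra! h3; exact h1 ⟨h3.trans h2.le, h3⟩, h2⟩
  have col2 : ∀ u v, col u v = 2 → 0 ≤ f u v ∧ 0 ≤ g u v := by
    intro u v h
    simp only [col] at h
    split_ifs at h with h1 h2
    · exact h1
    · exact absurd h (by decide)
    · exact absurd h (by decide)
  obtain ⟨u, hu, v, hv, h⟩ := exists_three_coloured_cell P Q col
    (fun u hu h => by have := col1 u 0 h; have := hbottom u hu this.1; omega)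
    (fun v hv h => by have := col0 0 v h; have := hleft v hv this.1; omega)
    (fun v hv h => by have := col2 P v h; have := hright v hv; omega)
    (fun u hu h => by have := col2 u Q h; have := htop u hu; omega)
  have a1 := abs_le.1 (hfu u v)
  have a2 := abs_le.1 (hfu u (v + 1))
  have a3 := abs_le.1 (hfv u v)
  have a4 := abs_le.1 (hfv (u + 1) v)
  have b1 := abs_le.1 (hgu u v)
  have b2 := abs_le.1 (hgu u (v + 1))
  have b3 := abs_le.1 (hgv u v)
  have b4 := abs_le.1 (hgv (u + 1) v)
  have hX : ∃ fx < 0, ∀ i ∈ [0, 1], ∀ j ∈ [0, 1], |f (u + i) (v + j) - fx| ≤ 2 * L := by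
    rcases h 0 with h | h | h | h <;>
    · refine ⟨_, (col0 _ _ h).1, ?_⟩
      simp only [List.mem_cons, List.not_mem_nil, or_false, forall_eq_or_imp, forall_eq, add_zero,
        abs_le]
      omega
  have hY : ∃ gy < 0, ∀ i ∈ [0, 1], ∀ j ∈ [0, 1], |g (u + i) (v + j) - gy| ≤ 2 * L := by
    rcases h 1 with h | h | h | h <;>
    · refine ⟨_, (col1 _ _ h).1, ?_⟩
      simp only [List.mem_cons, List.not_mem_nil, or_false, forall_eq_or_imp, forall_eq, add_zero,
        abs_le]
      omega
  have hZ : ∃ i ∈ [0, 1], ∃ j ∈ [0, 1], 0 ≤ f (u + i) (v + j) ∧ 0 ≤ g (u + i) (v + j) := by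
    rcases h 2 with h | h | h | h
    · exact ⟨0, by simp, 0, by simp, col2 _ _ h⟩
    · exact ⟨1, by simp, 0, by simp, col2 _ _ h⟩
    · exact ⟨1, by simp, 1, by simp, col2 _ _ h⟩
    · exact ⟨0, by simp, 1, by simp, col2 _ _ h⟩
  obtain ⟨i, hi, j, hj, hf, hg⟩ := hZ
  obtain ⟨fx, x1, x2⟩ := hX
  obtain ⟨gy, y1, y2⟩ := hY
  have x3 := abs_le.1 (x2 i hi j hj)
  have y3 := abs_le.1 (y2 i hi j hj)
  have hi' : i ≤ 1 := by simp at hi; omega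
  have hj' : j ≤ 1 := by simp at hj; omega
  exact ⟨u + i, by omega, v + j, by omega, abs_le.2 ⟨by omega, by omega⟩,
    abs_le.2 ⟨by omega, by omega⟩⟩

/-! ### Conditions given by two prefixes -/

theorem KC_swap {U : CondMachine} (hU : OptimalMachine U) :
    ∃ d : ℕ, ∀ (w x z : Str) (R : List Str),
      KC U w (cnd ([], R, x, z)) ≤ KC U w (cnd ([], R, z, x)) + d := by
  have h := Primrec.snd.comp primrec_uncnd
  have hx := Primrec.fst.comp (Primrec.snd.comp h)
  have hz := Primrec.snd.comp (Primrec.snd.comp h)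
  obtain ⟨d, hd⟩ := KC_le_comp hU (primrec_cnd.comp (Primrec.pair (Primrec.const ([] : Str))
    (Primrec.pair (Primrec.fst.comp h) (Primrec.pair hz hx))))
  exact ⟨d, fun w x z R => by simpa using hd w (cnd ([], R, x, z))⟩

theorem KC_step {U : CondMachine} (hU : OptimalMachine U) :
    ∃ L : ℕ, ∀ (w s z : Str) (R : List Str) (u : ℕ),
      |(KC U w (cnd ([], R, s.take (u + 1), z)) : ℤ) - KC U w (cnd ([], R, s.take u, z))| ≤ L := by
  have h : Primrec fun q : Str × ℕ => (uncnd q.1).2 :=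
    Primrec.snd.comp (primrec_uncnd.comp Primrec.fst)
  have hx := Primrec.fst.comp (Primrec.snd.comp h)
  have hz := Primrec.snd.comp (Primrec.snd.comp h)
  let bits : ℕ → Str := fun t => [[], [false], [true]].getD t []
  have hbits : Primrec bits := (Primrec.list_getD []).comp (Primrec.const _) Primrec.id
  have hF : Primrec fun q : Str × ℕ =>
      cnd ([], (uncnd q.1).2.1, (uncnd q.1).2.2.1 ++ bits q.2, (uncnd q.1).2.2.2) :=
    primrec_cnd.comp (Primrec.pair (Primrec.const []) (Primrec.pair (Primrec.fst.comp h)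
      (Primrec.pair (Primrec.list_append.comp hx (hbits.comp Primrec.snd)) hz)))
  have hG : Primrec fun q : Str × ℕ => cnd ([], (uncnd q.1).2.1,
      (uncnd q.1).2.2.1.take ((uncnd q.1).2.2.1.length - q.2), (uncnd q.1).2.2.2) :=
    primrec_cnd.comp (Primrec.pair (Primrec.const []) (Primrec.pair (Primrec.fst.comp h)
      (Primrec.pair (Primrec.list_take.comp (Primrec.nat_sub.comp (Primrec.list_length.comp hx)
        Primrec.snd) hx) hz)))
  obtain ⟨d₁, hd₁⟩ := KC_transform hU (Computable.partrec hF.to_comp) Partrec.some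
  obtain ⟨d₂, hd₂⟩ := KC_transform hU (Computable.partrec hG.to_comp) Partrec.some
  refine ⟨2 * 2 + d₁ + d₂, fun w s z R u => ?_⟩
  have e₁ : ∃ t < 2 ^ 2, s.take (u + 1) = s.take u ++ bits t := by
    rcases Nat.lt_or_ge u s.length with hu | hu
    · rw [List.take_succ_eq_append_getElem hu]
      rcases s[u] with _ | _
      · exact ⟨1, by norm_num, rfl⟩
      · exact ⟨2, by norm_num, rfl⟩
    · exact ⟨0, by norm_num, by
        simp [bits, List.take_of_length_le hu, List.take_of_length_le (hu.trans (Nat.le_succ u))]⟩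
  have e₂ : ∃ t < 2 ^ 2, s.take u = (s.take (u + 1)).take ((s.take (u + 1)).length - t) := by
    rcases Nat.lt_or_ge u s.length with hu | hu
    · refine ⟨1, by norm_num, ?_⟩
      rw [List.take_take, List.length_take]
      congr 1
      omega
    · refine ⟨0, by norm_num, ?_⟩
      simp [List.take_of_length_le hu, List.take_of_length_le (hu.trans (Nat.le_succ u))]
  obtain ⟨t₁, ht₁, e₁⟩ := e₁
  obtain ⟨t₂, ht₂, e₂⟩ := e₂
  have f₁ := hd₁ (cnd ([], R, s.take u, z)) (cnd ([], R, s.take (u + 1), z)) w w t₁ 2 ht₁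
    (by simp [← e₁]) (Part.mem_some _)
  have f₂ := hd₂ (cnd ([], R, s.take (u + 1), z)) (cnd ([], R, s.take u, z)) w w t₂ 2 ht₂
    (by simpa using congrArg (fun x => cnd ([], R, x, z)) e₂) (Part.mem_some _)
  rw [abs_le]
  push_cast
  omega

theorem KC_tag_le {U : CondMachine} (hU : OptimalMachine U) :
    ∃ d : ℕ, ∀ (n : ℕ) (a p z : Str), p.length ≤ n → a ∈ U.1 (p, []) → ∀ R ∈ tables n,
      KC U a (cnd ([], R, tag R p, z)) ≤ d := by
  have hy : Primrec fun q : (Str × ℕ) × Str => (uncnd q.2).2 :=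
    Primrec.snd.comp (primrec_uncnd.comp Primrec.snd)
  have hV : Primrec fun q : (Str × ℕ) × Str =>
      (uncnd q.2).2.2.1.drop (uncnd q.2).2.1.headI.length :=
    Primrec.list_drop.comp
      (Primrec.list_length.comp (Primrec.list_headI.comp (Primrec.fst.comp hy)))
      (Primrec.fst.comp (Primrec.snd.comp hy))
  obtain ⟨d₁, hd₁⟩ := KC_le_of_partrec hU (Computable.partrec hV.to_comp)
  obtain ⟨d₂, hd₂⟩ := KC_le_of_program hU
  refine ⟨d₁ + d₂, fun n a p z hp ha R hR => ?_⟩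
  have hhead : R.headI.length = n := by
    obtain ⟨hl, hrows⟩ := mem_tables.1 hR
    cases R with
    | nil => exact absurd hl.symm (by positivity)
    | cons r R => exact hrows r (by simp)
  have h1 := hd₁ [] 0 (cnd ([], R, tag R p, z)) p 0 (by simp) (by
    simp [hhead, tag, length_row hR hp])
  have h2 := hd₂ a p (cnd ([], R, tag R p, z)) ha
  simp only [List.length_nil] at h1
  omega

/-- Theorem 3: for all strings `a, b` (with `n = C(a) + C(b)`) and all
nonnegative integers `α, β` with `α ≤ C(a) - c·log n`, `β ≤ C(b) - c·log n`,
and `-C(a|b) + c·log n ≤ β - α ≤ C(b|a) - c·log n`, there exists a string `y`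
with `C(a|y) = α + O(1)` and `C(b|y) = β + O(1)`. -/
theorem muchnik_combination (U : CondMachine) (hU : OptimalMachine U) :
    ∃ c : ℕ, ∀ a b : Str, ∀ α β : ℕ,
      (α : ℤ) ≤ (KC U a [] : ℤ) - (c : ℤ) * (log2 (KC U a [] + KC U b []) : ℤ) →
      (β : ℤ) ≤ (KC U b [] : ℤ) - (c : ℤ) * (log2 (KC U a [] + KC U b []) : ℤ) →
      -(KC U a b : ℤ) + (c : ℤ) * (log2 (KC U a [] + KC U b []) : ℤ) ≤ (β : ℤ) - (α : ℤ) →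
      (β : ℤ) - (α : ℤ) ≤ (KC U b a : ℤ) - (c : ℤ) * (log2 (KC U a [] + KC U b []) : ℤ) →
      ∃ y : Str, |(KC U a y : ℤ) - (α : ℤ)| ≤ (c : ℤ) ∧
        |(KC U b y : ℤ) - (β : ℤ)| ≤ (c : ℤ) := by
  classical
  obtain ⟨D, hD⟩ := exists_few_bad_tables hU
  obtain ⟨cs, hswap⟩ := KC_swap hU
  obtain ⟨l, hstep⟩ := KC_step hU
  obtain ⟨c₀, hfull⟩ := KC_tag_le hU
  let K := c₀ + cs + 1
  let L := l + 2 * cs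
  refine ⟨D + K + 2 * cs + 1 + 2 * L, fun a b α β hα hβ hab hba => ?_⟩
  set n := KC U a [] + KC U b [] with hn
  obtain ⟨p, hpl, hap, badA, hbadA, hA⟩ := hD a b n hn.ge
  obtain ⟨q, hql, hbq, badB, hbadB, hB⟩ := hD b a n (by omega)
  obtain ⟨R, hR, hRbad⟩ : ∃ R ∈ tables n, R ∉ badA ∪ badB := by
    by_contra! hall
    have := (Finset.card_le_card hall).trans (Finset.card_union_le _ _)
    have := card_tables_pos n
    omega
  rw [Finset.mem_union, not_or] at hRbad
  let cond : ℕ → ℕ → Str := fun u v => cnd ([], R, (tag R p).take u, (tag R q).take v)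
  have hstep' : ∀ w u v, |(KC U w (cond u (v + 1)) : ℤ) - KC U w (cond u v)| ≤ L := by
    intro w u v
    have h1 := abs_le.1 (hstep w (tag R q) ((tag R p).take u) R v)
    have h2 := hswap w ((tag R p).take u) ((tag R q).take v) R
    have h3 := hswap w ((tag R p).take u) ((tag R q).take (v + 1)) R
    have h4 := hswap w ((tag R q).take v) ((tag R p).take u) R
    have h5 := hswap w ((tag R q).take (v + 1)) ((tag R p).take u) R
    rw [abs_le]
    simp only [cond, L]
    push_cast
    omega
  have hstep'' : ∀ w u v, |(KC U w (cond (u + 1) v) : ℤ) - KC U w (cond u v)| ≤ L := fun w u v =>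
    (hstep w (tag R p) ((tag R q).take v) R u).trans (by simp only [L]; push_cast; omega)
  have hfullA : ∀ v, KC U a (cond (n + p.length) v) ≤ c₀ := fun v => by
    have h := hfull n a p ((tag R q).take v) (by omega) hap R hR
    simp only [cond]
    rwa [List.take_of_length_le (by simp [tag, length_row hR (show p.length ≤ n by omega)])]
  have hfullB : ∀ u, KC U b (cond u (n + q.length)) ≤ c₀ + cs := fun u => by
    have h := hfull n b q ((tag R p).take u) (by omega) hbq R hR
    have h' := hswap b ((tag R p).take u) (tag R q) R
    simp only [cond]
    rw [List.take_of_length_le (l := tag R q)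
      (by simp [tag, length_row hR (show q.length ≤ n by omega)])]
    omega
  have hlog : (1 : ℤ) ≤ log2 n := by exact_mod_cast log2_pos n
  have hc : ((D + K + 2 * cs + 1 + 2 * L : ℕ) : ℤ) * log2 n ≥
      (D * log2 n : ℕ) + (K + 2 * cs + 1 : ℕ) := by
    push_cast
    nlinarith
  have hK : (K : ℤ) = c₀ + cs + 1 := by simp [K]
  obtain ⟨u, -, v, -, hf, hg⟩ := exists_near_zero (n + p.length) (n + q.length) L
    (fun u v => (KC U a (cond u v) : ℤ) - (α + K)) (fun u v => (KC U b (cond u v) : ℤ) - (β + K))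
    (fun u v => by simpa using hstep'' a u v) (fun u v => by simpa using hstep' a u v)
    (fun u v => by simpa using hstep'' b u v) (fun u v => by simpa using hstep' b u v)
    (fun u hu h => by
      have h1 := hA R hR hRbad.1 u (by omega)
      simp only [cond, List.take_zero] at h ⊢
      rcases min_le_iff.1 h1 with h1 | h1 <;> omega)
    (fun v hv h => by
      have h1 := hB R hR hRbad.2 v (by omega)
      have h2 := hswap a ((tag R q).take v) [] R
      have h3 := hswap b [] ((tag R q).take v) R
      simp only [cond, List.take_zero] at h ⊢
      rcases min_le_iff.1 h1 with h1 | h1 <;> omega)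
    (fun v _ => by have := hfullA v; omega)
    (fun u _ => by have := hfullB u; omega)
  have hf' := abs_le.1 hf
  have hg' := abs_le.1 hg
  refine ⟨cond u v, abs_le.2 ?_, abs_le.2 ?_⟩ <;> push_cast <;> omega
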